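/- arXiv:2110.06146 — 3 statements merged into one kernel-verified Lean document; each statement's English description precedes it below -/
import Mathlib

section
/- No graph on at most 10 vertices has twin-width exactly 5. -/
/-!
Twin-width, formalized via contraction sequences.

A sequence of `d`-contractions for a graph `G` is modeled by the sequence of
partitions of the vertex set of `G` whose parts are the sets of original
vertices merged (by the successive contractions) into a single vertex of the
current trigraph.  Under this correspondence, two distinct parts are joined by
a red edge precisely when they are "mixed" in `G` (neither completely adjacent
nor completely nonadjacent), and by a black edge when completely adjacent.
-/

/-- Parts `P` and `Q` form a red (mixed) pair with respect to `G`: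
neither complete nor anticomplete between them. -/
def SimpleGraph.MixedPair {V : Type*} (G : SimpleGraph V) (P Q : Set V) : Prop :=
  (¬ ∀ x ∈ P, ∀ y ∈ Q, G.Adj x y) ∧ (¬ ∀ x ∈ P, ∀ y ∈ Q, ¬ G.Adj x y)

/-- The red degree of the part `P` within the partition `parts`:
the number of other parts forming a red pair with `P`. -/
noncomputable def SimpleGraph.redDeg {V : Type*} (G : SimpleGraph V)
    (parts : Set (Set V)) (P : Set V) : ℕ :=
  {Q ∈ parts | Q ≠ P ∧ G.MixedPair P Q}.ncard

/-- `Q` is obtained from `P` by contracting (merging) two distinct parts. -/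
def TwwStep {V : Type*} (P Q : Set (Set V)) : Prop :=
  ∃ A ∈ P, ∃ B ∈ P, A ≠ B ∧ Q = insert (A ∪ B) (P \ {A, B})

/-- `G` admits a sequence of `d`-contractions: a contraction sequence leading from
the partition of the vertex set into singletons to the partition with the single
part `univ` (i.e. the one-vertex trigraph), in which every vertex of every
intermediate trigraph has red degree at most `d`. -/
def SimpleGraph.HasDSeq {V : Type*} (G : SimpleGraph V) (d : ℕ) : Prop :=
  ∃ (N : ℕ) (f : ℕ → Set (Set V)),
    f 0 = Set.range (fun v => ({v} : Set V)) ∧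
    (∀ i < N, TwwStep (f i) (f (i + 1))) ∧
    f N = {Set.univ} ∧
    ∀ i ≤ N, ∀ P ∈ f i, G.redDeg (f i) P ≤ d

/-- The twin-width of `G`: the least `d` such that `G` admits a `d`-sequence. -/
noncomputable def SimpleGraph.twinWidth {V : Type*} (G : SimpleGraph V) : ℕ :=
  sInf {d | G.HasDSeq d}

universe u

namespace TwinWidthTen

/-! ### Contraction strategies on bit masks -/

/-- The vertex sets encoded by the masks `A` and `B` are complete or anticomplete to each other. -/
def Homog (K : SimpleGraph ℕ) (A B : ℕ) : Prop :=
  (∀ x y, A.testBit x → B.testBit y → K.Adj x y) ∨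
    (∀ x y, A.testBit x → B.testBit y → x ≠ y ∧ ¬ K.Adj x y)

/-- Every part of the list has at most four other parts to which it is not homogeneous. -/
def RedOK (K : SimpleGraph ℕ) (L : List ℕ) : Prop :=
  ∀ P ∈ L, ∃ X : List ℕ, X.length ≤ 4 ∧ ∀ Q ∈ L, Q = P ∨ Homog K P Q ∨ Q ∈ X

/-- The partition listed in `L` can be contracted to a single part with red degree at most four. -/
inductive Win (K : SimpleGraph ℕ) : List ℕ → Prop
  | done {L : List ℕ} : L.length ≤ 1 → Win K L
  | step {L R : List ℕ} {A B : ℕ} : L.Perm (A :: B :: R) → RedOK K ((A ||| B) :: R) →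
      Win K ((A ||| B) :: R) → Win K L

lemma redOK_of_length_le {K : SimpleGraph ℕ} {L : List ℕ} (h : L.length ≤ 5) : RedOK K L := by
  intro P hP
  refine ⟨L.erase P, ?_, fun Q hQ => ?_⟩
  · rw [List.length_erase_of_mem hP]; omega
  · by_cases hQP : Q = P
    · exact Or.inl hQP
    · exact Or.inr (Or.inr ((List.mem_erase_of_ne hQP).2 hQ))

lemma win_of_length_le {K : SimpleGraph ℕ} :
    ∀ (n : ℕ) (L : List ℕ), L.length ≤ n → n ≤ 6 → Win K L
  | 0, _, h, _ => .done (by omega)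
  | n + 1, [], _, _ => .done (by simp)
  | n + 1, [_], _, _ => .done (by simp)
  | n + 1, A :: B :: R, h, hn => by
    simp only [List.length_cons] at h
    exact .step (List.Perm.refl _) (redOK_of_length_le (by simp only [List.length_cons]; omega))
      (win_of_length_le n _ (by simp only [List.length_cons]; omega) (by omega))

/-- The partition `P` can be contracted to a single part with red degree at most `d`. -/
def Contracts {V : Type*} (G : SimpleGraph V) (d : ℕ) (P : Set (Set V)) : Prop :=
  ∃ (N : ℕ) (f : ℕ → Set (Set V)), f 0 = P ∧ (∀ i < N, TwwStep (f i) (f (i + 1))) ∧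
    f N = {Set.univ} ∧ ∀ i ≤ N, ∀ A ∈ f i, G.redDeg (f i) A ≤ d

lemma Contracts.cons {V : Type*} {G : SimpleGraph V} {d : ℕ} {P Q : Set (Set V)}
    (hPQ : TwwStep P Q) (hP : ∀ A ∈ P, G.redDeg P A ≤ d) (hQ : Contracts G d Q) :
    Contracts G d P := by
  obtain ⟨N, f, h0, hs, hN, hr⟩ := hQ
  refine ⟨N + 1, fun i => Nat.casesOn i P f, rfl, fun i hi => ?_, hN, fun i hi => ?_⟩
  · cases i with
    | zero => simpa [h0] using hPQ
    | succ i => exact hs i (by omega)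
  · cases i with
    | zero => exact hP
    | succ i => exact hr i (by omega)

/-- The set of vertices whose label belongs to the mask `A`. -/
def cell {V : Type*} (e : V → ℕ) (A : ℕ) : Set V := {v | A.testBit (e v)}

/-- The nonempty cells of a list of masks. -/
def cells {V : Type*} (e : V → ℕ) (L : List ℕ) : Set (Set V) :=
  {P | P.Nonempty ∧ ∃ A ∈ L, P = cell e A}

lemma cell_or {V : Type*} (e : V → ℕ) (A B : ℕ) : cell e (A ||| B) = cell e A ∪ cell e B := by
  ext v; simp [cell]

lemma cells_perm {V : Type*} (e : V → ℕ) {L M : List ℕ} (h : L.Perm M) :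
    cells e L = cells e M := by
  simp only [cells, h.mem_iff]

lemma cells_cons {V : Type*} (e : V → ℕ) (A : ℕ) (L : List ℕ) :
    cells e (A :: L) = {P | P.Nonempty ∧ P = cell e A} ∪ cells e L := by
  ext P
  simp only [cells, List.mem_cons, exists_eq_or_imp, Set.mem_ofPred_eq, Set.mem_union]
  tauto

lemma redDeg_cells_le {V : Type*} {G : SimpleGraph V} {K : SimpleGraph ℕ} {e : V → ℕ}
    (hG : ∀ u v, G.Adj u v ↔ K.Adj (e u) (e v)) {L : List ℕ} (h : RedOK K L) :
    ∀ P ∈ cells e L, G.redDeg (cells e L) P ≤ 4 := by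
  rintro _ ⟨-, A, hA, rfl⟩
  obtain ⟨X, hX, hXL⟩ := h A hA
  classical
  have hsub : {Q ∈ cells e L | Q ≠ cell e A ∧ G.MixedPair (cell e A) Q} ⊆
      ((X.map (cell e)).toFinset : Set (Set V)) := by
    rintro _ ⟨⟨-, B, hB, rfl⟩, hne, hm⟩
    rcases hXL B hB with rfl | hh | hh
    · exact absurd rfl hne
    · rcases hh with hh | hh
      · exact absurd (fun x hx y hy => (hG x y).2 (hh _ _ hx hy)) hm.1
      · exact absurd (fun x hx y hy hxy => (hh _ _ hx hy).2 ((hG x y).1 hxy)) hm.2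
    · simp only [List.coe_toFinset, List.mem_map, Set.mem_ofPred_eq]
      exact ⟨B, hh, rfl⟩
  refine (Set.ncard_le_ncard hsub (Finset.finite_toSet _)).trans ?_
  rw [Set.ncard_coe_finset]
  refine (List.toFinset_card_le _).trans ?_
  simpa using hX

lemma twwStep_cells {V : Type*} {e : V → ℕ} {A B : ℕ} {R : List ℕ}
    (hd : (A :: B :: R).Pairwise fun C D => Disjoint (cell e C) (cell e D)) :
    cells e ((A ||| B) :: R) = cells e (A :: B :: R) ∨
      TwwStep (cells e (A :: B :: R)) (cells e ((A ||| B) :: R)) := by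
  simp only [List.pairwise_cons, List.mem_cons, forall_eq_or_imp] at hd
  obtain ⟨⟨hAB, hAR⟩, hBR, -⟩ := hd
  simp only [cells_cons, cell_or]
  rcases Set.eq_empty_or_nonempty (cell e A) with hA | hA
  · left
    ext P
    simp only [hA, Set.mem_union, Set.mem_ofPred_eq, Set.empty_union]
    constructor
    · tauto
    · rintro (⟨h1, rfl⟩ | h | h)
      · simp at h1
      · exact Or.inl h
      · exact Or.inr h
  rcases Set.eq_empty_or_nonempty (cell e B) with hB | hB
  · left
    ext P
    simp only [hB, Set.mem_union, Set.mem_ofPred_eq, Set.union_empty]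
    constructor
    · tauto
    · rintro (h | ⟨h1, rfl⟩ | h)
      · exact Or.inl h
      · simp at h1
      · exact Or.inr h
  right
  refine ⟨cell e A, Or.inl ⟨hA, rfl⟩, cell e B, Or.inr (Or.inl ⟨hB, rfl⟩), ?_, ?_⟩
  · intro h
    rw [h, disjoint_self] at hAB
    exact hB.ne_empty hAB
  · ext P
    simp only [Set.mem_union, Set.mem_ofPred_eq, Set.mem_insert_iff, Set.mem_sdiff,
      Set.mem_singleton_iff, not_or]
    constructor
    · rintro (⟨-, rfl⟩ | ⟨hP, C, hC, rfl⟩)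
      · exact Or.inl rfl
      · refine Or.inr ⟨Or.inr (Or.inr ⟨hP, C, hC, rfl⟩), fun h => ?_, fun h => ?_⟩
        · have := hAR C hC
          rw [← h, disjoint_self] at this
          exact hP.ne_empty this
        · have := hBR C hC
          rw [← h, disjoint_self] at this
          exact hP.ne_empty this
    · rintro (rfl | ⟨h1 | h1 | h1, h2, h3⟩)
      · exact Or.inl ⟨hA.mono Set.subset_union_left, rfl⟩
      · exact absurd h1.2 h2
      · exact absurd h1.2 h3
      · exact Or.inr h1

lemma contracts_of_win {V : Type*} [Nonempty V] {G : SimpleGraph V} {K : SimpleGraph ℕ}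
    {e : V → ℕ} (hG : ∀ u v, G.Adj u v ↔ K.Adj (e u) (e v)) {L : List ℕ} (hL : Win K L)
    (hok : RedOK K L) (hd : L.Pairwise fun C D => Disjoint (cell e C) (cell e D))
    (hc : ∀ v, ∃ A ∈ L, A.testBit (e v)) : Contracts G 4 (cells e L) := by
  induction hL with
  | @done L hlen =>
    obtain ⟨v⟩ := ‹Nonempty V›
    match L, hlen with
    | [], _ => simpa using hc v
    | [A], _ =>
      have hA : cell e A = Set.univ := by
        ext v; simpa [cell] using hc v
      have hcells : cells e [A] = {Set.univ} := by
        ext P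
        simp only [cells, List.mem_singleton, exists_eq_left, hA, Set.mem_ofPred_eq,
          Set.mem_singleton_iff]
        constructor
        · exact fun h => h.2
        · rintro rfl
          exact ⟨⟨v, trivial⟩, rfl⟩
      refine ⟨0, fun _ => cells e [A], rfl, by simp, hcells, fun _ _ => redDeg_cells_le hG hok⟩
  | @step L R A B hp hok' _ ih =>
    have hd' := (hp.pairwise_iff fun {_ _} h => Disjoint.symm h).1 hd
    have ih' : Contracts G 4 (cells e ((A ||| B) :: R)) := by
      refine ih hok' ?_ fun v => ?_
      · simp only [List.pairwise_cons, List.mem_cons, forall_eq_or_imp] at hd'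
        refine List.pairwise_cons.2 ⟨fun C hC => ?_, hd'.2.2⟩
        rw [cell_or]
        exact Set.disjoint_union_left.2 ⟨hd'.1.2 C hC, hd'.2.1 C hC⟩
      · obtain ⟨C, hC, hv⟩ := hc v
        rw [hp.mem_iff] at hC
        simp only [List.mem_cons] at hC ⊢
        rcases hC with rfl | rfl | hC
        · exact ⟨_, Or.inl rfl, by simp [hv]⟩
        · exact ⟨_, Or.inl rfl, by simp [hv]⟩
        · exact ⟨C, Or.inr hC, hv⟩
    have hred := redDeg_cells_le hG hok
    rw [cells_perm e hp] at hred ⊢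
    rcases twwStep_cells hd' with h | h
    · rwa [← h]
    · exact ih'.cons h hred

/-- The partition of `{0, …, 9}` into singletons. -/
def singles : List ℕ := [1, 2, 4, 8, 16, 32, 64, 128, 256, 512]

lemma singles_eq : singles = (List.range 10).map (2 ^ ·) := by decide

lemma homog_two_pow (K : SimpleGraph ℕ) {x y : ℕ} (hxy : x ≠ y) : Homog K (2 ^ x) (2 ^ y) := by
  by_cases h : K.Adj x y
  · exact Or.inl fun u v hu hv => by
      rw [Nat.testBit_two_pow, decide_eq_true_eq] at hu hv
      rwa [← hu, ← hv]
  · exact Or.inr fun u v hu hv => by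
      rw [Nat.testBit_two_pow, decide_eq_true_eq] at hu hv
      rw [← hu, ← hv]
      exact ⟨hxy, h⟩

lemma homog_singles (K : SimpleGraph ℕ) {P Q : ℕ} (hP : P ∈ singles) (hQ : Q ∈ singles)
    (hne : Q ≠ P) : Homog K P Q := by
  simp only [singles_eq, List.mem_map] at hP hQ
  obtain ⟨x, -, rfl⟩ := hP
  obtain ⟨y, -, rfl⟩ := hQ
  exact homog_two_pow K fun h => hne (h ▸ rfl)

lemma redOK_singles (K : SimpleGraph ℕ) : RedOK K singles := fun P hP =>
  ⟨[], by simp, fun Q hQ => (eq_or_ne Q P).imp_right fun h =>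
    Or.inl (homog_singles K hP hQ h)⟩

lemma hasDSeq_of_win {V : Type*} [Nonempty V] {G : SimpleGraph V} {K : SimpleGraph ℕ}
    {e : V → ℕ} (he : Function.Injective e) (he10 : ∀ v, e v < 10)
    (hG : ∀ u v, G.Adj u v ↔ K.Adj (e u) (e v)) (hK : Win K singles) : G.HasDSeq 4 := by
  have hcell : ∀ v, cell e (2 ^ e v) = {v} := by
    intro v
    ext w
    simp only [cell, Nat.testBit_two_pow, decide_eq_true_eq, Set.mem_ofPred_eq,
      Set.mem_singleton_iff]
    exact ⟨fun h => (he h).symm, fun h => h ▸ rfl⟩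
  have hcells : cells e singles = Set.range fun v => ({v} : Set V) := by
    ext P
    simp only [cells, singles_eq, List.mem_map, List.mem_range, Set.mem_ofPred_eq, Set.mem_range]
    constructor
    · rintro ⟨⟨v, hv⟩, _, ⟨x, -, rfl⟩, rfl⟩
      have hx : x = e v := by simpa [cell, Nat.testBit_two_pow] using hv
      exact ⟨v, by rw [hx, hcell]⟩
    · rintro ⟨v, rfl⟩
      exact ⟨⟨v, rfl⟩, _, ⟨e v, he10 v, rfl⟩, (hcell v).symm⟩
  obtain ⟨N, f, h0, h⟩ := contracts_of_win hG hK (redOK_singles K) (by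
    rw [singles_eq, List.pairwise_map]
    refine List.nodup_range.imp fun {x y} hxy => Set.disjoint_left.2 fun v hx hy => hxy ?_
    simp only [cell, Nat.testBit_two_pow, decide_eq_true_eq, Set.mem_ofPred_eq] at hx hy
    omega) fun v => ⟨2 ^ e v, by
      rw [singles_eq]
      exact List.mem_map.2 ⟨e v, List.mem_range.2 (he10 v), rfl⟩, by simp⟩
  exact ⟨N, f, h0.trans hcells, h⟩

/-! ### Relabelling -/

lemma Homog.compl {K : SimpleGraph ℕ} {A B : ℕ} (h : Homog K A B) : Homog Kᶜ A B := by
  rcases h with h | h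
  · exact Or.inr fun x y hx hy => ⟨(h x y hx hy).ne, fun h' => h'.2 (h x y hx hy)⟩
  · exact Or.inl fun x y hx hy => h x y hx hy

lemma RedOK.compl {K : SimpleGraph ℕ} {L : List ℕ} (h : RedOK K L) : RedOK Kᶜ L := fun P hP => by
  obtain ⟨X, hX, h⟩ := h P hP
  exact ⟨X, hX, fun Q hQ => (h Q hQ).imp_right (Or.imp_left Homog.compl)⟩

lemma Win.compl {K : SimpleGraph ℕ} {L : List ℕ} (h : Win K L) : Win Kᶜ L := by
  induction h with
  | done h => exact .done h
  | step hp hr _ ih => exact .step hp hr.compl ih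

/-- A relabelling of the vertices that preserves `{0, …, 9}`. -/
structure Relabels (l : ℕ → ℕ) : Prop where
  injective : Function.Injective l
  lt_ten : ∀ i < 10, l i < 10

lemma Relabels.comp {l l' : ℕ → ℕ} (h : Relabels l) (h' : Relabels l') : Relabels (l ∘ l') :=
  ⟨h.injective.comp h'.injective, fun i hi => h.lt_ten _ (h'.lt_ten i hi)⟩

lemma Relabels.exists_eq {l : ℕ → ℕ} (h : Relabels l) {j : ℕ} (hj : j < 10) :
    ∃ i < 10, l i = j := by
  have := Finset.surj_on_of_inj_on_of_card_le (s := Finset.range 10) (t := Finset.range 10)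
    (fun i _ => l i) (fun i hi => by simpa using h.lt_ten i (by simpa using hi))
    (fun _ _ _ _ h' => h.injective h') le_rfl j (by simpa using hj)
  obtain ⟨i, hi, rfl⟩ := this
  exact ⟨i, by simpa using hi, rfl⟩

/-- Some relabelling of `K` admits a contraction strategy. -/
def Solvable (K : SimpleGraph ℕ) : Prop := ∃ l, Relabels l ∧ Win (K.comap l) singles

lemma Solvable.of_win {K : SimpleGraph ℕ} (h : Win K singles) : Solvable K :=
  ⟨id, ⟨Function.injective_id, fun _ => id⟩, by simpa using h⟩

lemma Solvable.of_comap {K : SimpleGraph ℕ} {l : ℕ → ℕ} (hl : Relabels l)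
    (h : Solvable (K.comap l)) : Solvable K := by
  obtain ⟨l', hl', h⟩ := h
  exact ⟨l ∘ l', hl.comp hl', by rwa [← SimpleGraph.comap_comap]⟩

lemma Solvable.of_compl {K : SimpleGraph ℕ} (h : Solvable Kᶜ) : Solvable K := by
  obtain ⟨l, hl, h⟩ := h
  refine ⟨l, hl, ?_⟩
  convert h.compl using 1
  ext x y
  simp only [SimpleGraph.comap_adj, SimpleGraph.compl_adj, ne_eq, not_and, not_not]
  have := hl.injective.eq_iff (a := x) (b := y)
  have hne : K.Adj (l x) (l y) → l x ≠ l y := SimpleGraph.Adj.ne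
  tauto

/-- The relabelling that sends `i` to the `i`-th entry of `L`. -/
def lab (L : List ℕ) (i : ℕ) : ℕ := L.getD i i

lemma relabels_lab {L : List ℕ} (h : L.Perm (List.range 10)) : Relabels (lab L) := by
  have hlen : L.length = 10 := by simpa using h.length_eq
  have hnd : L.Nodup := h.nodup_iff.2 List.nodup_range
  have hlt : ∀ i < 10, lab L i < 10 := fun i hi => by
    have : L[i]'(by omega) ∈ List.range 10 := h.mem_iff.1 (List.getElem_mem _)
    rw [lab, List.getD_eq_getElem (hn := show i < L.length by omega)]
    exact List.mem_range.1 this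
  have hge : ∀ i, 10 ≤ i → lab L i = i := fun i hi =>
    List.getD_eq_default _ _ (by omega)
  refine ⟨fun i j hij => ?_, hlt⟩
  rcases lt_or_ge i 10 with hi | hi <;> rcases lt_or_ge j 10 with hj | hj
  · rw [lab, lab, List.getD_eq_getElem (hn := show i < L.length by omega),
      List.getD_eq_getElem (hn := show j < L.length by omega)] at hij
    exact (hnd.getElem_inj_iff).1 hij
  · have := hlt i hi
    have := hge j hj
    omega
  · have := hlt j hj
    have := hge i hi
    omega
  · rwa [hge i hi, hge j hj] at hij

/-! ### Explicit strategies -/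

/-- Red degrees are at most four if the pairs in `T` are homogeneous. -/
def redCheck (T : List (ℕ × ℕ)) (L : List ℕ) : Bool :=
  L.all fun P => (L.filter fun Q => !(Q == P || T.contains (P, Q) || T.contains (Q, P) ||
    (singles.contains P && singles.contains Q))).length ≤ 4

/-- The given merges lead to at most six parts, provided the pairs in `T` are homogeneous. -/
def movesCheck (T : List (ℕ × ℕ)) : List (ℕ × ℕ) → List ℕ → Bool
  | [], L => L.length ≤ 6
  | (A, B) :: ms, L => L.contains A && (L.erase A).contains B &&
      redCheck T ((A ||| B) :: (L.erase A).erase B) &&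
      movesCheck T ms ((A ||| B) :: (L.erase A).erase B)

lemma Homog.symm {K : SimpleGraph ℕ} {A B : ℕ} (h : Homog K A B) : Homog K B A :=
  h.imp (fun h x y hx hy => (h y x hy hx).symm)
    (fun h x y hx hy => ⟨(h y x hy hx).1.symm, fun h' => (h y x hy hx).2 h'.symm⟩)

lemma redOK_of_redCheck {K : SimpleGraph ℕ} {T : List (ℕ × ℕ)} (hT : ∀ t ∈ T, Homog K t.1 t.2)
    {L : List ℕ} (h : redCheck T L = true) : RedOK K L := by
  intro P hP
  rw [redCheck, List.all_eq_true] at h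
  refine ⟨_, of_decide_eq_true (h P hP), fun Q hQ => ?_⟩
  simp only [List.mem_filter, hQ, true_and, Bool.not_eq_true', Bool.or_eq_false_iff]
  by_cases h1 : Q = P
  · exact Or.inl h1
  by_cases h2 : (P, Q) ∈ T
  · exact Or.inr (Or.inl (hT _ h2))
  by_cases h3 : (Q, P) ∈ T
  · exact Or.inr (Or.inl (hT _ h3).symm)
  by_cases h4 : P ∈ singles ∧ Q ∈ singles
  · exact Or.inr (Or.inl (homog_singles K h4.1 h4.2 h1))
  · exact Or.inr (Or.inr (by simpa [h1, h2, h3] using h4))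

lemma win_of_movesCheck {K : SimpleGraph ℕ} {T : List (ℕ × ℕ)} (hT : ∀ t ∈ T, Homog K t.1 t.2)
    {ms : List (ℕ × ℕ)} {L : List ℕ} (h : movesCheck T ms L = true) : Win K L := by
  induction ms generalizing L with
  | nil => exact win_of_length_le 6 L (of_decide_eq_true h) le_rfl
  | cons m ms ih =>
    obtain ⟨A, B⟩ := m
    simp only [movesCheck, Bool.and_eq_true, List.contains_iff_mem] at h
    obtain ⟨⟨⟨hA, hB⟩, hr⟩, hm⟩ := h
    exact .step ((List.perm_cons_erase hA).trans ((List.perm_cons_erase hB).cons A))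
      (redOK_of_redCheck hT hr) (ih hm)

/-- The vertices `u` and `v` are in the same relation to `x`. -/
def Agree (K : SimpleGraph ℕ) (x u v : ℕ) : Prop := K.Adj x u ↔ K.Adj x v

lemma Homog.of_agree {K : SimpleGraph ℕ} {x u v : ℕ} (h : Agree K x u v) (hu : u ≠ x) (hv : v ≠ x) :
    Homog K (2 ^ u ||| 2 ^ v) (2 ^ x) := by
  have hh : ∀ y z, (2 ^ u ||| 2 ^ v).testBit y → (2 ^ x).testBit z →
      z = x ∧ y ≠ x ∧ (K.Adj x y ↔ K.Adj x u) := by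
    intro y z hy hz
    simp only [Nat.testBit_or, Nat.testBit_two_pow, Bool.or_eq_true, decide_eq_true_eq] at hy hz
    rcases hy with rfl | rfl
    · exact ⟨hz.symm, hu, Iff.rfl⟩
    · exact ⟨hz.symm, hv, h.symm⟩
  by_cases hx : K.Adj x u
  · exact Or.inl fun y z hy hz => by
      obtain ⟨rfl, -, h⟩ := hh y z hy hz
      exact (h.2 hx).symm
  · exact Or.inr fun y z hy hz => by
      obtain ⟨rfl, hne, h⟩ := hh y z hy hz
      exact ⟨hne, fun h' => hx (h.1 h'.symm)⟩

lemma Homog.or {K : SimpleGraph ℕ} {A u x : ℕ} (h : Homog K (A ||| 2 ^ u) (2 ^ x)) {v : ℕ}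
    (ha : Agree K x u v) (hv : v ≠ x) : Homog K (A ||| 2 ^ u ||| 2 ^ v) (2 ^ x) := by
  have hu : (A ||| 2 ^ u).testBit u = true := by simp
  have hx : (2 ^ x).testBit x = true := by simp
  refine h.imp (fun h y z hy hz => ?_) (fun h y z hy hz => ?_) <;>
    (rw [Nat.testBit_or, Bool.or_eq_true] at hy; rcases hy with hy | hy)
  · exact h y z hy hz
  · rw [Nat.testBit_two_pow, decide_eq_true_eq] at hy hz
    subst hy hz
    exact (ha.1 (h u x hu hx).symm).symm
  · exact h y z hy hz
  · rw [Nat.testBit_two_pow, decide_eq_true_eq] at hy hz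
    subst hy hz
    exact ⟨hv, fun h' => (h u x hu hx).2 (ha.2 h'.symm).symm⟩

/-- The triple `{0, 1, 2}` is homogeneous to `3`, `4` and `5`. -/
def TripleHom (K : SimpleGraph ℕ) : Prop :=
  (Agree K 3 0 1 ∧ Agree K 3 1 2) ∧ (Agree K 4 0 1 ∧ Agree K 4 1 2) ∧ Agree K 5 0 1 ∧ Agree K 5 1 2

/-- Three configurations on `{6, 7, 8, 9}` that allow two further contractions. -/
def Extendable (K : SimpleGraph ℕ) : Prop :=
  (Agree K 3 6 7 ∧ Agree K 9 6 7 ∧ Agree K 3 7 8) ∨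
    (Agree K 3 6 7 ∧ Agree K 4 6 7 ∧ Agree K 3 8 9) ∨
      Agree K 3 6 7 ∧ Agree K 8 6 7 ∧ Agree K 3 8 9

lemma win_of_extendable {K : SimpleGraph ℕ} (hT : TripleHom K) (h6 : Agree K 6 0 1)
    (hE : Extendable K) : Win K singles := by
  obtain ⟨⟨h3, h3'⟩, ⟨h4, h4'⟩, h5, h5'⟩ := hT
  have t3 := Homog.of_agree h3 (by decide) (by decide)
  have t4 := Homog.of_agree h4 (by decide) (by decide)
  have t5 := Homog.of_agree h5 (by decide) (by decide)
  have t6 := Homog.of_agree h6 (by decide) (by decide)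
  have s3 := t3.or h3' (by decide)
  have s4 := t4.or h4' (by decide)
  have s5 := t5.or h5' (by decide)
  rcases hE with ⟨h, h', h''⟩ | ⟨h, h', h''⟩ | ⟨h, h', h''⟩
  · have u := Homog.of_agree h (by decide) (by decide)
    have u' := Homog.of_agree h' (by decide) (by decide)
    have u'' := u.or h'' (by decide)
    exact win_of_movesCheck (T := [(3, 8), (3, 16), (3, 32), (3, 64), (7, 8), (7, 16), (7, 32),
      (192, 8), (192, 512), (448, 8)]) (ms := [(1, 2), (3, 4), (64, 128), (192, 256)])
      (by
        simp only [Nat.reducePow, Nat.reduceOr] at t3 t4 t5 t6 s3 s4 s5 u u' u''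
        simp only [List.forall_mem_cons]
        exact ⟨t3, t4, t5, t6, s3, s4, s5, u, u', u'', by simp⟩) (by decide)
  · have u := Homog.of_agree h (by decide) (by decide)
    have u' := Homog.of_agree h' (by decide) (by decide)
    have u'' := Homog.of_agree h'' (by decide) (by decide)
    exact win_of_movesCheck (T := [(3, 8), (3, 16), (3, 32), (3, 64), (7, 8), (7, 16), (7, 32),
      (192, 8), (192, 16), (768, 8)]) (ms := [(1, 2), (3, 4), (64, 128), (256, 512)])
      (by
        simp only [Nat.reducePow, Nat.reduceOr] at t3 t4 t5 t6 s3 s4 s5 u u' u''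
        simp only [List.forall_mem_cons]
        exact ⟨t3, t4, t5, t6, s3, s4, s5, u, u', u'', by simp⟩) (by decide)
  · have u := Homog.of_agree h (by decide) (by decide)
    have u' := Homog.of_agree h' (by decide) (by decide)
    have u'' := Homog.of_agree h'' (by decide) (by decide)
    exact win_of_movesCheck (T := [(3, 8), (3, 16), (3, 32), (3, 64), (7, 8), (7, 16), (7, 32),
      (192, 8), (192, 256), (768, 8)]) (ms := [(1, 2), (3, 4), (64, 128), (256, 512)])
      (by
        simp only [Nat.reducePow, Nat.reduceOr] at t3 t4 t5 t6 s3 s4 s5 u u' u''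
        simp only [List.forall_mem_cons]
        exact ⟨t3, t4, t5, t6, s3, s4, s5, u, u', u'', by simp⟩) (by decide)

lemma agree_pigeonhole (K : SimpleGraph ℕ) (x u v w : ℕ) :
    Agree K x u v ∨ Agree K x u w ∨ Agree K x v w := by
  unfold Agree; tauto

lemma agree_comap {K : SimpleGraph ℕ} {l : ℕ → ℕ} {x u v : ℕ} :
    Agree (K.comap l) x u v ↔ Agree K (l x) (l u) (l v) := Iff.rfl

lemma Solvable.of_lab {K : SimpleGraph ℕ} (L : List ℕ) (hL : L.Perm (List.range 10))
    (h : Solvable (K.comap (lab L))) : Solvable K := h.of_comap (relabels_lab hL)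

lemma solvable_of_extendable {K : SimpleGraph ℕ} (hT : TripleHom K) (hE : Extendable K) :
    Solvable K := by
  rcases agree_pigeonhole K 6 0 1 2 with h | h | h
  · exact .of_win (win_of_extendable hT h hE)
  · refine .of_lab [0, 2, 1, 3, 4, 5, 6, 7, 8, 9] (by decide) (.of_win
      (win_of_extendable ?_ ?_ ?_)) <;>
    simp only [TripleHom, Extendable, Agree, SimpleGraph.comap_adj, lab, List.getD_cons_zero,
      List.getD_cons_succ] at * <;> grind
  · refine .of_lab [1, 2, 0, 3, 4, 5, 6, 7, 8, 9] (by decide) (.of_win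
      (win_of_extendable ?_ ?_ ?_)) <;>
    simp only [TripleHom, Extendable, Agree, SimpleGraph.comap_adj, lab, List.getD_cons_zero,
      List.getD_cons_succ] at * <;> grind

lemma solvable_of_agree_three {K : SimpleGraph ℕ} (hT : TripleHom K) (h : Agree K 3 6 7)
    (h' : Agree K 3 7 8) : Solvable K := by
  rcases agree_pigeonhole K 9 6 7 8 with h9 | h9 | h9
  · exact solvable_of_extendable hT (Or.inl ⟨h, h9, h'⟩)
  · refine .of_lab [0, 1, 2, 3, 4, 5, 6, 8, 7, 9] (by decide)
      (solvable_of_extendable ?_ (Or.inl ?_)) <;>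
    simp only [TripleHom, Agree, SimpleGraph.comap_adj, lab, List.getD_cons_zero,
      List.getD_cons_succ] at * <;> grind
  · refine .of_lab [0, 1, 2, 3, 4, 5, 7, 8, 6, 9] (by decide)
      (solvable_of_extendable ?_ (Or.inl ?_)) <;>
    simp only [TripleHom, Agree, SimpleGraph.comap_adj, lab, List.getD_cons_zero,
      List.getD_cons_succ] at * <;> grind

/-- The vertex `x` distinguishes the pairs `{u, v}` and `{w, y}`, and neither of them internally. -/
def Splits (K : SimpleGraph ℕ) (x u v w y : ℕ) : Prop :=
  Agree K x u v ∧ Agree K x w y ∧ ¬ Agree K x u w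

lemma splits_three {K : SimpleGraph ℕ} (hT : TripleHom K) (hK : ¬ Solvable K) :
    Splits K 3 6 7 8 9 ∨ Splits K 3 6 8 7 9 ∨ Splits K 3 6 9 7 8 := by
  have h1 : ¬ (Agree K 3 6 7 ∧ Agree K 3 7 8) := fun h => hK (solvable_of_agree_three hT h.1 h.2)
  have h2 : ¬ (Agree K 3 6 7 ∧ Agree K 3 7 9) := fun h => hK <| by
    refine .of_lab [0, 1, 2, 3, 4, 5, 6, 7, 9, 8] (by decide) (solvable_of_agree_three ?_ ?_ ?_) <;>
    simp only [TripleHom, Agree, SimpleGraph.comap_adj, lab, List.getD_cons_zero,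
      List.getD_cons_succ] at * <;> grind
  have h3 : ¬ (Agree K 3 6 8 ∧ Agree K 3 8 9) := fun h => hK <| by
    refine .of_lab [0, 1, 2, 3, 4, 5, 6, 8, 9, 7] (by decide) (solvable_of_agree_three ?_ ?_ ?_) <;>
    simp only [TripleHom, Agree, SimpleGraph.comap_adj, lab, List.getD_cons_zero,
      List.getD_cons_succ] at * <;> grind
  have h4 : ¬ (Agree K 3 7 8 ∧ Agree K 3 8 9) := fun h => hK <| by
    refine .of_lab [0, 1, 2, 3, 4, 5, 7, 8, 9, 6] (by decide) (solvable_of_agree_three ?_ ?_ ?_) <;>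
    simp only [TripleHom, Agree, SimpleGraph.comap_adj, lab, List.getD_cons_zero,
      List.getD_cons_succ] at * <;> grind
  unfold Splits Agree at *
  grind

lemma splits_four {K : SimpleGraph ℕ} (hT : TripleHom K) (hK : ¬ Solvable K) :
    Splits K 4 6 7 8 9 ∨ Splits K 4 6 8 7 9 ∨ Splits K 4 6 9 7 8 := by
  have h := splits_three (K := K.comap (lab [0, 1, 2, 4, 3, 5, 6, 7, 8, 9])) (by
    simp only [TripleHom, Agree, SimpleGraph.comap_adj, lab, List.getD_cons_zero,
      List.getD_cons_succ] at *
    grind) fun h => hK (h.of_lab _ (by decide))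
  simpa only [Splits, Agree, SimpleGraph.comap_adj, lab, List.getD_cons_zero,
    List.getD_cons_succ] using h

lemma splits_five {K : SimpleGraph ℕ} (hT : TripleHom K) (hK : ¬ Solvable K) :
    Splits K 5 6 7 8 9 ∨ Splits K 5 6 8 7 9 ∨ Splits K 5 6 9 7 8 := by
  have h := splits_three (K := K.comap (lab [0, 1, 2, 5, 4, 3, 6, 7, 8, 9])) (by
    simp only [TripleHom, Agree, SimpleGraph.comap_adj, lab, List.getD_cons_zero,
      List.getD_cons_succ] at *
    grind) fun h => hK (h.of_lab _ (by decide))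
  simpa only [Splits, Agree, SimpleGraph.comap_adj, lab, List.getD_cons_zero,
    List.getD_cons_succ] using h

lemma not_splits_three_four {K : SimpleGraph ℕ} (hT : TripleHom K) (hK : ¬ Solvable K) :
    ¬ (Splits K 3 6 7 8 9 ∧ Splits K 4 6 7 8 9) ∧ ¬ (Splits K 3 6 8 7 9 ∧ Splits K 4 6 8 7 9) ∧
      ¬ (Splits K 3 6 9 7 8 ∧ Splits K 4 6 9 7 8) := by
  refine ⟨fun h => hK (solvable_of_extendable hT (Or.inr (Or.inl ⟨h.1.1, h.2.1, h.1.2.1⟩))),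
    fun h => hK ?_, fun h => hK ?_⟩
  · refine .of_lab [0, 1, 2, 3, 4, 5, 6, 8, 7, 9] (by decide)
      (solvable_of_extendable ?_ (Or.inr (Or.inl ?_))) <;>
    simp only [TripleHom, Splits, Agree, SimpleGraph.comap_adj, lab, List.getD_cons_zero,
      List.getD_cons_succ] at * <;> grind
  · refine .of_lab [0, 1, 2, 3, 4, 5, 6, 9, 7, 8] (by decide)
      (solvable_of_extendable ?_ (Or.inr (Or.inl ?_))) <;>
    simp only [TripleHom, Splits, Agree, SimpleGraph.comap_adj, lab, List.getD_cons_zero,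
      List.getD_cons_succ] at * <;> grind

lemma not_splits_three_five {K : SimpleGraph ℕ} (hT : TripleHom K) (hK : ¬ Solvable K) :
    ¬ (Splits K 3 6 7 8 9 ∧ Splits K 5 6 7 8 9) ∧ ¬ (Splits K 3 6 8 7 9 ∧ Splits K 5 6 8 7 9) ∧
      ¬ (Splits K 3 6 9 7 8 ∧ Splits K 5 6 9 7 8) := by
  have h := not_splits_three_four (K := K.comap (lab [0, 1, 2, 3, 5, 4, 6, 7, 8, 9])) (by
    simp only [TripleHom, Agree, SimpleGraph.comap_adj, lab, List.getD_cons_zero,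
      List.getD_cons_succ] at *
    grind) fun h => hK (h.of_lab _ (by decide))
  simpa only [Splits, Agree, SimpleGraph.comap_adj, lab, List.getD_cons_zero,
    List.getD_cons_succ] using h

lemma not_splits_four_five {K : SimpleGraph ℕ} (hT : TripleHom K) (hK : ¬ Solvable K) :
    ¬ (Splits K 4 6 7 8 9 ∧ Splits K 5 6 7 8 9) ∧ ¬ (Splits K 4 6 8 7 9 ∧ Splits K 5 6 8 7 9) ∧
      ¬ (Splits K 4 6 9 7 8 ∧ Splits K 5 6 9 7 8) := by
  have h := not_splits_three_five (K := K.comap (lab [0, 1, 2, 4, 3, 5, 6, 7, 8, 9])) (by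
    simp only [TripleHom, Agree, SimpleGraph.comap_adj, lab, List.getD_cons_zero,
      List.getD_cons_succ] at *
    grind) fun h => hK (h.of_lab _ (by decide))
  simpa only [Splits, Agree, SimpleGraph.comap_adj, lab, List.getD_cons_zero,
    List.getD_cons_succ] using h

lemma not_splits_nine {K : SimpleGraph ℕ} (hT : TripleHom K) (hK : ¬ Solvable K) :
    (Splits K 3 6 7 8 9 → ¬ Agree K 9 6 7) ∧ (Splits K 3 6 8 7 9 → ¬ Agree K 9 6 8) ∧
      (Splits K 3 6 9 7 8 → ¬ Agree K 9 7 8) := by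
  refine ⟨fun h h9 => hK ?_, fun h h9 => hK ?_, fun h h9 => hK ?_⟩
  · refine .of_lab [0, 1, 2, 3, 4, 5, 6, 7, 9, 8] (by decide)
      (solvable_of_extendable ?_ (Or.inr (Or.inr ?_))) <;>
    simp only [TripleHom, Splits, Agree, SimpleGraph.comap_adj, lab, List.getD_cons_zero,
      List.getD_cons_succ] at * <;> grind
  · refine .of_lab [0, 1, 2, 3, 4, 5, 6, 8, 9, 7] (by decide)
      (solvable_of_extendable ?_ (Or.inr (Or.inr ?_))) <;>
    simp only [TripleHom, Splits, Agree, SimpleGraph.comap_adj, lab, List.getD_cons_zero,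
      List.getD_cons_succ] at * <;> grind
  · refine .of_lab [0, 1, 2, 3, 4, 5, 7, 8, 9, 6] (by decide)
      (solvable_of_extendable ?_ (Or.inr (Or.inr ?_))) <;>
    simp only [TripleHom, Splits, Agree, SimpleGraph.comap_adj, lab, List.getD_cons_zero,
      List.getD_cons_succ] at * <;> grind

lemma solvable_of_tripleHom {K : SimpleGraph ℕ} (hT : TripleHom K) : Solvable K := by
  by_contra hK
  have h9 := agree_pigeonhole K 9 6 7 8
  have n3 := not_splits_nine hT hK
  have n4 : (Splits K 4 6 7 8 9 → ¬ Agree K 9 6 7) ∧ (Splits K 4 6 8 7 9 → ¬ Agree K 9 6 8) ∧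
      (Splits K 4 6 9 7 8 → ¬ Agree K 9 7 8) := by
    have h := not_splits_nine (K := K.comap (lab [0, 1, 2, 4, 3, 5, 6, 7, 8, 9])) (by
      simp only [TripleHom, Agree, SimpleGraph.comap_adj, lab, List.getD_cons_zero,
        List.getD_cons_succ] at *
      grind) fun h => hK (h.of_lab _ (by decide))
    simpa only [Splits, Agree, SimpleGraph.comap_adj, lab, List.getD_cons_zero,
      List.getD_cons_succ] using h
  have n5 : (Splits K 5 6 7 8 9 → ¬ Agree K 9 6 7) ∧ (Splits K 5 6 8 7 9 → ¬ Agree K 9 6 8) ∧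
      (Splits K 5 6 9 7 8 → ¬ Agree K 9 7 8) := by
    have h := not_splits_nine (K := K.comap (lab [0, 1, 2, 5, 4, 3, 6, 7, 8, 9])) (by
      simp only [TripleHom, Agree, SimpleGraph.comap_adj, lab, List.getD_cons_zero,
        List.getD_cons_succ] at *
      grind) fun h => hK (h.of_lab _ (by decide))
    simpa only [Splits, Agree, SimpleGraph.comap_adj, lab, List.getD_cons_zero,
      List.getD_cons_succ] using h
  have s3 := splits_three hT hK
  have s4 := splits_four hT hK
  have s5 := splits_five hT hK
  have d34 := not_splits_three_four hT hK
  have d35 := not_splits_three_five hT hK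
  have d45 := not_splits_four_five hT hK
  grind

/-! ### Kernel-friendly primitives -/

/-- `force n k = k n`, evaluating `n` first. -/
def force {α : Type} (n : ℕ) (k : ℕ → α) : α := Nat.rec (k 0) (fun m _ => k (Nat.succ m)) n

lemma force_eq {α : Type} (n : ℕ) (k : ℕ → α) : force n k = k n := by cases n <;> rfl

/-- Test for zero, unfolding directly to a recursor. -/
def ifZero {α : Type} (n : ℕ) (a b : α) : α := Nat.rec a (fun _ _ => b) n

lemma ifZero_eq {α : Type} (n : ℕ) (a b : α) : ifZero n a b = if n = 0 then a else b := by
  cases n <;> rfl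

/-- Conjunction, unfolding directly to a recursor. -/
def both (a b : Bool) : Bool := Bool.rec false b a

lemma both_eq_true {a b : Bool} : both a b = true ↔ a = true ∧ b = true := by
  cases a <;> cases b <;> decide

/-- Disjunction, unfolding directly to a recursor. -/
def either (a b : Bool) : Bool := Bool.rec b true a

lemma either_eq_true {a b : Bool} : either a b = true ↔ a = true ∨ b = true := by
  cases a <;> cases b <;> decide

/-- `List.all`, unfolding directly to a recursor. -/
def forAll {α : Type} (L : List α) (p : α → Bool) : Bool :=
  List.rec true (fun x _ ih => both (p x) ih) L

lemma forAll_eq_true {α : Type} {L : List α} {p : α → Bool} :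
    forAll L p = true ↔ ∀ x ∈ L, p x = true := by
  induction L with
  | nil => simp [forAll]
  | cons x L ih =>
    rw [List.forall_mem_cons, ← ih, ← both_eq_true]
    rfl

/-- The number below `2 ^ n` whose binary digits are given by `f`. -/
def bits (f : ℕ → Bool) (n : ℕ) : ℕ :=
  Nat.rec 0 (fun j ih => Bool.rec ih (Nat.lor ih (Nat.pow 2 j)) (f j)) n

lemma bits_succ (f : ℕ → Bool) (n : ℕ) :
    bits f (n + 1) = if f n then bits f n ||| 2 ^ n else bits f n := by
  change (Bool.rec (bits f n) (bits f n ||| 2 ^ n) (f n) : ℕ) = _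
  cases f n <;> rfl

lemma testBit_bits (f : ℕ → Bool) (n i : ℕ) : (bits f n).testBit i = (decide (i < n) && f i) := by
  induction n with
  | zero => simp [bits]
  | succ n ih =>
    rw [bits_succ]
    rcases lt_trichotomy i n with h | rfl | h
    · split_ifs <;> simp [ih, h, h.ne', h.trans (Nat.lt_succ_self n)]
    · split_ifs with h <;> simp [ih, h]
    · have h1 : ¬ i < n := by omega
      have h2 : ¬ i < n + 1 := by omega
      split_ifs <;> simp [ih, h1, h2, h.ne]

lemma bits_lt (f : ℕ → Bool) (n : ℕ) : bits f n < 2 ^ n :=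
  Nat.lt_pow_two_of_testBit _ fun i hi => by simp [testBit_bits, Nat.not_lt.2 hi]

lemma land_two_pow_eq_zero {x n : ℕ} : Nat.land x (Nat.pow 2 n) = 0 ↔ x.testBit n = false := by
  change x &&& 2 ^ n = 0 ↔ _
  rw [Nat.and_two_pow]
  cases x.testBit n <;> simp

lemma testBit_lor' (x y i : ℕ) : (Nat.lor x y).testBit i = (x.testBit i || y.testBit i) :=
  Nat.testBit_or x y i

lemma testBit_land' (x y i : ℕ) : (Nat.land x y).testBit i = (x.testBit i && y.testBit i) :=
  Nat.testBit_and x y i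

lemma testBit_xor' (x y i : ℕ) : (Nat.xor x y).testBit i = (x.testBit i ^^ y.testBit i) :=
  Nat.testBit_xor x y i

lemma testBit_shift' (x s i : ℕ) :
    (Nat.shiftLeft x s).testBit i = (decide (s ≤ i) && x.testBit (i - s)) :=
  Nat.testBit_shiftLeft x

lemma testBit_mod' (x j i : ℕ) :
    (Nat.mod x (Nat.pow 2 j)).testBit i = (decide (i < j) && x.testBit i) :=
  Nat.testBit_mod_two_pow x j i

lemma testBit_full (k i : ℕ) : (Nat.sub (Nat.pow 2 k) 1).testBit i = decide (i < k) :=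
  Nat.testBit_two_pow_sub_one k i

lemma land_eq_zero {x y : ℕ} (h : ∀ i, x.testBit i → y.testBit i → False) : Nat.land x y = 0 := by
  by_contra hne
  obtain ⟨i, hi⟩ := Nat.exists_testBit_of_ne_zero hne
  rw [testBit_land', Bool.and_eq_true] at hi
  exact h i hi.1 hi.2

/-! ### Searching for a contraction strategy of a concrete graph -/

/-- A part with mask `A`, and sets of common neighbours and of common non-neighbours. -/
inductive Part
  | mk (A p n : ℕ)

namespace Part

/-- The mask of a part. -/
noncomputable def mask (o : Part) : ℕ := Part.rec (fun A _ _ => A) o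

/-- The union of two parts. -/
noncomputable def merge (o o' : Part) : Part :=
  Part.rec (fun A p n => Part.rec (fun A' p' n' =>
    .mk (Nat.lor A A') (Nat.land p p') (Nat.land n n')) o') o

/-- Soundness of the neighbour sets stored with a part. -/
def Valid (K : SimpleGraph ℕ) : Part → Prop
  | .mk A p n => (∀ x y, A.testBit x → p.testBit y → K.Adj x y) ∧
      (∀ x y, A.testBit x → n.testBit y → x ≠ y ∧ ¬ K.Adj x y)

lemma mask_merge (o o' : Part) : (merge o o').mask = o.mask ||| o'.mask := by
  cases o; cases o'; rfl

lemma Valid.merge {K : SimpleGraph ℕ} {o o' : Part} (h : o.Valid K) (h' : o'.Valid K) :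
    (o.merge o').Valid K := by
  cases o with | mk A p n => ?_
  cases o' with | mk A' p' n' => ?_
  constructor <;> intro x y hx hy <;>
    simp only [testBit_lor', testBit_land', Bool.or_eq_true, Bool.and_eq_true] at hx hy <;>
    rcases hx with hx | hx
  · exact h.1 x y hx hy.1
  · exact h'.1 x y hx hy.2
  · exact h.2 x y hx hy.1
  · exact h'.2 x y hx hy.2

/-- At most `c` parts in `L` are different from `A` and not inside `p` or `n`. -/
noncomputable def fewRed (A p n : ℕ) (L : List Part) : ℕ → Bool :=
  List.rec (fun _ => true) (fun o _ ih c => force (mask o) fun Q =>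
    ifZero (Nat.sub Q (Nat.land Q p)) (ih c) (ifZero (Nat.sub Q (Nat.land Q n)) (ih c)
      (Bool.rec (Nat.rec false (fun c' _ => ih c') c) (ih c) (Nat.beq Q A)))) L

/-- The part `o` has red degree at most four in `L`. -/
noncomputable def ok (L : List Part) (o : Part) : Bool := Part.rec (fun A p n => fewRed A p n L 4) o

/-- Concatenation, unfolding directly to a recursor. -/
noncomputable def append (L M : List Part) : List Part := List.rec M (fun x _ ih => x :: ih) L

/-- Try to merge `A` with some element of `L`. -/
noncomputable def pickSecond (k : List Part → Bool) (A : Part) (L : List Part) : List Part → Bool :=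
  List.rec (fun _ => false) (fun B tl ih acc =>
    either (k (merge A B :: append acc tl)) (ih (B :: acc))) L

/-- Try to merge some two elements of `L`. -/
noncomputable def pickFirst (k : List Part → Bool) (L : List Part) : List Part → Bool :=
  List.rec (fun _ => false) (fun A tl ih acc =>
    either (pickSecond k A tl acc) (ih (A :: acc))) L

/-- Exhaustive search for `fuel` admissible contractions. -/
noncomputable def dfs (fuel : ℕ) : List Part → Bool :=
  Nat.rec (fun _ => true) (fun _ ih L =>
    pickFirst (fun L => both (forAll L (ok L)) (ih L)) L []) fuel

lemma sub_land_eq_zero {Q p : ℕ} (h : Nat.sub Q (Nat.land Q p) = 0) {x : ℕ}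
    (hx : Q.testBit x) : p.testBit x := by
  have h1 : Q ≤ Q &&& p := Nat.sub_eq_zero_iff_le.1 h
  have h2 : Q &&& p = Q := le_antisymm Nat.and_le_left h1
  rw [← h2, Nat.testBit_and, Bool.and_eq_true] at hx
  exact hx.2

lemma fewRed_spec {K : SimpleGraph ℕ} {A p n : ℕ} (hv : (Part.mk A p n).Valid K)
    {L : List Part} {c : ℕ} (h : fewRed A p n L c = true) :
    ∃ X : List ℕ, X.length ≤ c ∧ ∀ Q ∈ L.map mask, Q = A ∨ Homog K A Q ∨ Q ∈ X := by
  induction L generalizing c with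
  | nil => exact ⟨[], by simp, by simp⟩
  | cons o L ih =>
    have key : fewRed A p n (o :: L) c =
        force (mask o) fun Q =>
        ifZero (Nat.sub Q (Nat.land Q p)) (fewRed A p n L c)
          (ifZero (Nat.sub Q (Nat.land Q n)) (fewRed A p n L c)
          (Bool.rec (Nat.rec false (fun c' _ => fewRed A p n L c') c) (fewRed A p n L c)
            (Nat.beq Q A))) := rfl
    rw [key, force_eq, ifZero_eq, ifZero_eq] at h
    have extend (h' : fewRed A p n L c = true) (ho : mask o = A ∨ Homog K A (mask o)) :
        ∃ X : List ℕ, X.length ≤ c ∧ ∀ Q ∈ (o :: L).map mask, Q = A ∨ Homog K A Q ∨ Q ∈ X := by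
      obtain ⟨X, hX, hL⟩ := ih h'
      refine ⟨X, hX, ?_⟩
      rw [List.map_cons, List.forall_mem_cons]
      exact ⟨by tauto, hL⟩
    split_ifs at h with h1 h2
    · exact extend h (Or.inr (Or.inl fun x y hx hy => hv.1 x y hx (sub_land_eq_zero h1 hy)))
    · exact extend h (Or.inr (Or.inr fun x y hx hy => hv.2 x y hx (sub_land_eq_zero h2 hy)))
    · cases hb : Nat.beq (mask o) A with
      | true =>
        rw [hb] at h
        exact extend h (Or.inl (Nat.eq_of_beq_eq_true hb))
      | false =>
        rw [hb] at h
        cases c with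
        | zero => cases h
        | succ c =>
          obtain ⟨X, hX, hL⟩ := ih h
          refine ⟨mask o :: X, by simpa using hX, ?_⟩
          rw [List.map_cons, List.forall_mem_cons]
          refine ⟨by simp, fun Q hQ => ?_⟩
          rcases hL Q hQ with h | h | h
          · exact Or.inl h
          · exact Or.inr (Or.inl h)
          · exact Or.inr (Or.inr (List.mem_cons_of_mem _ h))

lemma redOK_of_ok {K : SimpleGraph ℕ} {L : List Part} (hv : ∀ o ∈ L, o.Valid K)
    (h : forAll L (ok L) = true) : RedOK K (L.map mask) := by
  rw [forAll_eq_true] at h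
  intro P hP
  obtain ⟨o, ho, rfl⟩ := List.mem_map.1 hP
  have h1 := h o ho
  have h2 := hv o ho
  cases o with | mk A p n => exact fewRed_spec h2 h1

lemma append_eq (L M : List Part) : append L M = L ++ M := by
  induction L with
  | nil => rfl
  | cons x L ih => rw [List.cons_append, ← ih]; rfl

lemma pickSecond_spec {k : List Part → Bool} {A : Part} {L acc : List Part}
    (h : pickSecond k A L acc = true) :
    ∃ B R, (L ++ acc).Perm (B :: R) ∧ k (merge A B :: R) = true := by
  induction L generalizing acc with
  | nil => cases h
  | cons B L ih =>
    rcases either_eq_true.1 h with h | h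
    · exact ⟨B, _, (List.perm_append_comm.cons B).trans (by rw [append_eq]), h⟩
    · obtain ⟨C, R, hp, hk⟩ := ih h
      exact ⟨C, R, List.perm_middle.symm.trans hp, hk⟩

lemma pickFirst_spec {k : List Part → Bool} {L acc : List Part}
    (h : pickFirst k L acc = true) :
    ∃ A B R, (L ++ acc).Perm (A :: B :: R) ∧ k (merge A B :: R) = true := by
  induction L generalizing acc with
  | nil => cases h
  | cons A L ih =>
    rcases either_eq_true.1 h with h | h
    · obtain ⟨B, R, hp, hk⟩ := pickSecond_spec h
      exact ⟨A, B, R, hp.cons A, hk⟩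
    · obtain ⟨C, D, R, hp, hk⟩ := ih h
      exact ⟨C, D, R, List.perm_middle.symm.trans hp, hk⟩

lemma win_of_dfs {K : SimpleGraph ℕ} {fuel : ℕ} {L : List Part} (hL : L.length ≤ fuel + 6)
    (hv : ∀ o ∈ L, o.Valid K) (h : dfs fuel L = true) : Win K (L.map mask) := by
  induction fuel generalizing L with
  | zero => exact win_of_length_le 6 _ (by simpa using hL) le_rfl
  | succ fuel ih =>
    obtain ⟨A, B, R, hp, hk⟩ := pickFirst_spec h
    rw [List.append_nil] at hp
    obtain ⟨h1, h2⟩ := both_eq_true.1 hk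
    have hv' : ∀ o ∈ merge A B :: R, o.Valid K := by
      have hv1 : ∀ o ∈ A :: B :: R, o.Valid K := fun o ho => hv o (hp.mem_iff.2 ho)
      simp only [List.forall_mem_cons] at hv1 ⊢
      exact ⟨hv1.1.merge hv1.2.1, hv1.2.2⟩
    have hlen : (merge A B :: R).length ≤ fuel + 6 := by
      have := hp.length_eq
      simp only [List.length_cons] at this ⊢
      omega
    have hr := redOK_of_ok hv' h1
    have hw := ih hlen hv' h2
    rw [List.map_cons, mask_merge] at hr hw
    exact .step (by simpa using hp.map mask) hr hw

end Part

/-! ### Enumerating the graphs in which no triple is homogeneous to three vertices -/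

/-- The number of triples contained in `{0, …, h - 1}`. -/
def offset (h : ℕ) : ℕ := Nat.div (Nat.mul h (Nat.mul (Nat.sub h 1) (Nat.sub h 2))) 6

/-- The index of the pair `i < j`. -/
def pairIndex (i j : ℕ) : ℕ := Nat.div (Nat.mul j (Nat.sub j 1)) 2 + i

/-- The index of the triple `i < j < h`. -/
def tripleIndex (i j h : ℕ) : ℕ := pairIndex i j + offset h

/-- The set of indices of pairs inside `x`, restricted to elements below `n`. -/
def pairsBelow (x n : ℕ) : ℕ :=
  Nat.rec 0 (fun j ih => ifZero (Nat.land x (Nat.pow 2 j)) ih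
    (Nat.lor ih (Nat.shiftLeft (Nat.mod x (Nat.pow 2 j)) (Nat.div (Nat.mul j (Nat.sub j 1)) 2)))) n

/-- The set of indices of pairs inside `x`. -/
def pairs (x : ℕ) : ℕ := pairsBelow x 9

/-- The set of indices of triples inside `x`, restricted to elements below `n`. -/
def triplesBelow (x n : ℕ) : ℕ :=
  Nat.rec 0 (fun j ih => ifZero (Nat.land x (Nat.pow 2 j)) ih
    (Nat.lor ih (Nat.shiftLeft (force (Nat.mod x (Nat.pow 2 j)) pairs) (offset j)))) n

/-- The set of indices of triples inside `x`. -/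
def triples (x : ℕ) : ℕ := triplesBelow x 9

/-- The set of indices of triples inside `x` or inside its complement in `full`. -/
def homTriples (full x : ℕ) : ℕ := Nat.lor (triples x) (force (Nat.xor full x) triples)

lemma testBit_pairsBelow {x n q : ℕ} (h : (pairsBelow x n).testBit q) :
    ∃ i j, i < j ∧ j < n ∧ x.testBit i ∧ x.testBit j ∧ q = pairIndex i j := by
  induction n with
  | zero => simp [pairsBelow] at h
  | succ n ih =>
    have key : pairsBelow x (n + 1) = ifZero (Nat.land x (Nat.pow 2 n)) (pairsBelow x n)
      (Nat.lor (pairsBelow x n)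
        (Nat.shiftLeft (Nat.mod x (Nat.pow 2 n)) (Nat.div (Nat.mul n (Nat.sub n 1)) 2))) := rfl
    rw [key, ifZero_eq] at h
    have old (h : (pairsBelow x n).testBit q) :
        ∃ i j, i < j ∧ j < n + 1 ∧ x.testBit i ∧ x.testBit j ∧ q = pairIndex i j := by
      obtain ⟨i, j, h1, h2, h3⟩ := ih h
      exact ⟨i, j, h1, h2.trans n.lt_succ_self, h3⟩
    split_ifs at h with h0
    · exact old h
    · rw [testBit_lor', Bool.or_eq_true, testBit_shift', testBit_mod'] at h
      simp only [Bool.and_eq_true, decide_eq_true_eq] at h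
      rcases h with h | ⟨h1, h2, h3⟩
      · exact old h
      · rw [land_two_pow_eq_zero, Bool.not_eq_false] at h0
        exact ⟨_, n, h2, n.lt_succ_self, h3, h0, by unfold pairIndex; omega⟩

lemma testBit_pairs {x q : ℕ} (h : (pairs x).testBit q) :
    ∃ i j, i < j ∧ x.testBit i ∧ x.testBit j ∧ q = pairIndex i j := by
  obtain ⟨i, j, h1, -, h2⟩ := testBit_pairsBelow h
  exact ⟨i, j, h1, h2⟩

lemma testBit_triplesBelow {x n q : ℕ} (h : (triplesBelow x n).testBit q) :
    ∃ i j l, i < j ∧ j < l ∧ l < n ∧ x.testBit i ∧ x.testBit j ∧ x.testBit l ∧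
      q = tripleIndex i j l := by
  induction n with
  | zero => simp [triplesBelow] at h
  | succ n ih =>
    have key : triplesBelow x (n + 1) = ifZero (Nat.land x (Nat.pow 2 n)) (triplesBelow x n)
      (Nat.lor (triplesBelow x n)
        (Nat.shiftLeft (force (Nat.mod x (Nat.pow 2 n)) pairs) (offset n))) := rfl
    rw [key, ifZero_eq, force_eq] at h
    have old (h : (triplesBelow x n).testBit q) :
        ∃ i j l, i < j ∧ j < l ∧ l < n + 1 ∧ x.testBit i ∧ x.testBit j ∧ x.testBit l ∧
          q = tripleIndex i j l := by
      obtain ⟨i, j, l, h1, h2, h3, h4⟩ := ih h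
      exact ⟨i, j, l, h1, h2, h3.trans n.lt_succ_self, h4⟩
    split_ifs at h with h0
    · exact old h
    · rw [testBit_lor', Bool.or_eq_true, testBit_shift'] at h
      simp only [Bool.and_eq_true, decide_eq_true_eq] at h
      rcases h with h | ⟨h1, h2⟩
      · exact old h
      · obtain ⟨i, j, hij, hi, hj, hq⟩ := testBit_pairs h2
        rw [testBit_mod', Bool.and_eq_true, decide_eq_true_eq] at hi hj
        rw [land_two_pow_eq_zero, Bool.not_eq_false] at h0
        exact ⟨i, j, n, hij, hj.1, n.lt_succ_self, hi.2, hj.2, h0, by unfold tripleIndex; omega⟩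

/-- The vertex `v` is homogeneous to a triple with index `q`. -/
def HomTriple (K : SimpleGraph ℕ) (v q : ℕ) : Prop :=
  ∃ i j l, i < j ∧ j < l ∧ l < 10 ∧ q = tripleIndex i j l ∧
    ((K.Adj v i ∧ K.Adj v j ∧ K.Adj v l) ∨
      (¬ K.Adj v i ∧ ¬ K.Adj v j ∧ ¬ K.Adj v l ∧ v ≠ i ∧ v ≠ j ∧ v ≠ l))

open Classical in
/-- The neighbours of `v` below `k`. -/
noncomputable def row (K : SimpleGraph ℕ) (v k : ℕ) : ℕ := bits (fun j => decide (K.Adj v j)) k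

lemma testBit_row {K : SimpleGraph ℕ} {v k i : ℕ} :
    (row K v k).testBit i = true ↔ i < k ∧ K.Adj v i := by
  simp [row, testBit_bits]

open Classical in
lemma row_succ (K : SimpleGraph ℕ) (v k : ℕ) :
    row K v (k + 1) = if K.Adj v k then row K v k ||| 2 ^ k else row K v k := by
  simp [row, bits_succ]

lemma row_self_succ (K : SimpleGraph ℕ) (k : ℕ) : row K k (k + 1) = row K k k := by
  simp [row_succ]

lemma homTriple_of_testBit {K : SimpleGraph ℕ} {k v q : ℕ} (hkv : k ≤ v)
    (h : (homTriples (Nat.sub (Nat.pow 2 k) 1) (row K v k)).testBit q) : HomTriple K v q := by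
  rw [homTriples, testBit_lor', Bool.or_eq_true, force_eq] at h
  rcases h with h | h
  · obtain ⟨i, j, l, hij, hjl, hl, h1, h2, h3, hq⟩ := testBit_triplesBelow h
    rw [testBit_row] at h1 h2 h3
    exact ⟨i, j, l, hij, hjl, by omega, hq, Or.inl ⟨h1.2, h2.2, h3.2⟩⟩
  · obtain ⟨i, j, l, hij, hjl, hl, h1, h2, h3, hq⟩ := testBit_triplesBelow h
    have non {i : ℕ} (h : (Nat.xor (Nat.sub (Nat.pow 2 k) 1) (row K v k)).testBit i) :
        ¬ K.Adj v i ∧ v ≠ i := by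
      rw [testBit_xor', testBit_full] at h
      by_cases hi : i < k
      · have h' : ¬ (row K v k).testBit i = true := by simpa [hi] using h
        rw [testBit_row] at h'
        exact ⟨fun h => h' ⟨hi, h⟩, by omega⟩
      · have h' : (row K v k).testBit i = true := by simpa [hi] using h
        rw [testBit_row] at h'
        omega
    exact ⟨i, j, l, hij, hjl, by omega, hq, Or.inr
      ⟨(non h1).1, (non h2).1, (non h3).1, (non h1).2, (non h2).2, (non h3).2⟩⟩

/-- No triple is homogeneous to three vertices. -/
def NoTripleHom (K : SimpleGraph ℕ) : Prop :=
  ∀ q, ∀ u < 10, ∀ v < 10, ∀ w < 10, u ≠ v → u ≠ w → v ≠ w →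
    HomTriple K u q → HomTriple K v q → HomTriple K w q → False

/-- Every triple in `once` (in `twice`), with indices shifted by `s`, is homogeneous to at least
one (at least two) of the vertices below `v`. -/
def Counts (K : SimpleGraph ℕ) (s v once twice : ℕ) : Prop :=
  (∀ q, once.testBit q → ∃ u < v, HomTriple K u (q + s)) ∧
    (∀ q, twice.testBit q → ∃ u < v, ∃ w < v, u ≠ w ∧
      HomTriple K u (q + s) ∧ HomTriple K w (q + s))

lemma Counts.mono {K : SimpleGraph ℕ} {s v w o t : ℕ} (h : Counts K s v o t) (hvw : v ≤ w) :
    Counts K s w o t := by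
  refine ⟨fun q hq => ?_, fun q hq => ?_⟩
  · obtain ⟨u, hu, h⟩ := h.1 q hq
    exact ⟨u, hu.trans_le hvw, h⟩
  · obtain ⟨u, hu, u', hu', h⟩ := h.2 q hq
    exact ⟨u, hu.trans_le hvw, u', hu'.trans_le hvw, h⟩

/-- Adding the set `x` of triples homogeneous to `v`. -/
lemma Counts.add {K : SimpleGraph ℕ} {s v o t x : ℕ} (h : Counts K s v o t)
    (hx : ∀ q, x.testBit q → HomTriple K v (q + s)) :
    Counts K s (v + 1) (Nat.lor o x) (Nat.lor t (Nat.land o x)) := by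
  have h' := h.mono v.le_succ
  refine ⟨fun q hq => ?_, fun q hq => ?_⟩
  · rw [testBit_lor', Bool.or_eq_true] at hq
    rcases hq with hq | hq
    · exact h'.1 q hq
    · exact ⟨v, v.lt_succ_self, hx q hq⟩
  · rw [testBit_lor', Bool.or_eq_true, testBit_land', Bool.and_eq_true] at hq
    rcases hq with hq | ⟨hq, hq'⟩
    · exact h'.2 q hq
    · obtain ⟨u, hu, hh⟩ := h.1 q hq
      exact ⟨u, hu.trans v.lt_succ_self, v, v.lt_succ_self, hu.ne, hh, hx q hq'⟩

/-- Two families of counts can be combined. -/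
lemma Counts.lor {K : SimpleGraph ℕ} {s v o t o' t' : ℕ} (h : Counts K 0 v o t)
    (h' : Counts K s v o' t') :
    Counts K 0 v (Nat.lor o (Nat.shiftLeft o' s)) (Nat.lor t (Nat.shiftLeft t' s)) := by
  refine ⟨fun q hq => ?_, fun q hq => ?_⟩ <;>
    rw [testBit_lor', Bool.or_eq_true, testBit_shift', Bool.and_eq_true, decide_eq_true_eq] at hq <;>
    rcases hq with hq | ⟨hs, hq⟩
  · exact h.1 q hq
  · simpa [Nat.sub_add_cancel hs] using h'.1 _ hq
  · exact h.2 q hq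
  · simpa [Nat.sub_add_cancel hs] using h'.2 _ hq

lemma Counts.land_eq_zero {K : SimpleGraph ℕ} (hK : NoTripleHom K) {s v o t x w : ℕ}
    (h : Counts K s v o t) (hvw : v ≤ w) (hw : w < 10)
    (hx : ∀ q, x.testBit q → HomTriple K w (q + s)) : Nat.land t x = 0 := by
  refine TwinWidthTen.land_eq_zero fun q hq hq' => ?_
  obtain ⟨u, hu, u', hu', hne, h1, h2⟩ := h.2 q hq
  exact hK _ u (by omega) u' (by omega) w hw hne (by omega) (by omega) h1 h2 (hx q hq')

/-- The possible extensions of the rows in `L` by the vertex with bit `b`. -/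
def extend (full b t : ℕ) (L : List ℕ) : List ℕ :=
  List.rec [] (fun d _ ih =>
    ifZero (Nat.land t (homTriples full d))
      (force (Nat.lor d b) fun e => ifZero (Nat.land t (homTriples full e)) (d :: e :: ih) (d :: ih))
      (force (Nat.lor d b) fun e => ifZero (Nat.land t (homTriples full e)) (e :: ih) ih)) L

lemma mem_extend {full b t d : ℕ} {L : List ℕ} (hd : d ∈ L) :
    (Nat.land t (homTriples full d) = 0 → d ∈ extend full b t L) ∧
    (Nat.land t (homTriples full (d ||| b)) = 0 → (d ||| b) ∈ extend full b t L) := by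
  induction L with
  | nil => simp at hd
  | cons c L ih =>
    have key : extend full b t (c :: L) =
        ifZero (Nat.land t (homTriples full c))
      (force (c ||| b) fun e =>
        ifZero (Nat.land t (homTriples full e)) (c :: e :: extend full b t L)
          (c :: extend full b t L))
      (force (c ||| b) fun e =>
        ifZero (Nat.land t (homTriples full e)) (e :: extend full b t L)
          (extend full b t L)) := rfl
    simp only [key, force_eq, ifZero_eq]
    rw [List.mem_cons] at hd
    rcases hd with rfl | hd
    · split_ifs <;> simp_all
    · obtain ⟨h1, h2⟩ := ih hd
      split_ifs <;> (try simp only [List.mem_cons]) <;> tauto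

lemma row_mem_extend {K : SimpleGraph ℕ} (hK : NoTripleHom K) {k v o t : ℕ}
    (h : Counts K 0 (k + 1) o t) (hkv : k + 1 ≤ v) (hv : v < 10) {L : List ℕ}
    (hL : row K v k ∈ L) :
    row K v (k + 1) ∈ extend (Nat.sub (Nat.pow 2 (k + 1)) 1) (Nat.pow 2 k) t L := by
  have h0 := h.land_eq_zero hK hkv hv fun q hq => homTriple_of_testBit hkv hq
  have hm := mem_extend (full := Nat.sub (Nat.pow 2 (k + 1)) 1) (b := Nat.pow 2 k) (t := t) hL
  rw [row_succ] at h0 ⊢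
  split_ifs at h0 ⊢
  · exact hm.2 h0
  · exact hm.1 h0

/-- The earlier vertices in the same relation to `v` as the vertex with row `r`. -/
def sameSide (full N b r : ℕ) : ℕ := ifZero (Nat.land r b) (Nat.xor (Nat.lor N b) full) N

/-- Count the triples containing the new vertex with row `r` that are homogeneous to old ones. -/
def newTriples (full r : ℕ) (rows : List ℕ) : ℕ → ℕ → ℕ → (ℕ → ℕ → Bool) → Bool :=
  List.rec (fun _ o t c => c o t)
    (fun N _ ih b o t c => force (sameSide full N b r) fun x =>
      ifZero (Nat.land t (pairs x))
        (ih (Nat.mul 2 b) (Nat.lor o (pairs x)) (Nat.lor t (Nat.land o (pairs x))) c) true) rows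

lemma homTriple_of_testBit_sameSide {K : SimpleGraph ℕ} {k v q : ℕ} (hvk : v < k) (hk : k < 10)
    (h : (pairs (sameSide (Nat.sub (Nat.pow 2 k) 1) (row K v k) (2 ^ v) (row K k k))).testBit q) :
    HomTriple K v (q + offset k) := by
  obtain ⟨i, j, hij, hi, hj, rfl⟩ := testBit_pairs h
  have hz : Nat.land (row K k k) (2 ^ v) = 0 ↔ ¬ K.Adj v k := by
    rw [← Nat.pow_eq, land_two_pow_eq_zero, ← Bool.not_eq_true, testBit_row, K.adj_comm]
    tauto
  rw [sameSide, ifZero_eq] at hi hj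
  by_cases hvk' : K.Adj v k
  · rw [if_neg (by rwa [hz, not_not]), testBit_row] at hi hj
    exact ⟨i, j, k, hij, hj.1, hk, rfl, Or.inl ⟨hi.2, hj.2, hvk'⟩⟩
  · rw [if_pos (by rwa [hz])] at hi hj
    have non {i : ℕ} (h : (Nat.xor (Nat.lor (row K v k) (2 ^ v)) (Nat.sub (Nat.pow 2 k) 1)).testBit i) :
        i < k ∧ ¬ K.Adj v i ∧ v ≠ i := by
      rw [testBit_xor', testBit_full, testBit_lor', Nat.testBit_two_pow] at h
      by_cases hi : i < k
      · have h' : ¬ (row K v k).testBit i = true ∧ ¬ v = i := by simpa [hi] using h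
        rw [testBit_row] at h'
        exact ⟨hi, fun h => h'.1 ⟨hi, h⟩, h'.2⟩
      · have h' : (row K v k).testBit i = true ∨ v = i := by simpa [hi] using h
        rw [testBit_row] at h'
        omega
    exact ⟨i, j, k, hij, (non hj).1, hk, rfl, Or.inr
      ⟨(non hi).2.1, (non hj).2.1, hvk', (non hi).2.2, (non hj).2.2, hvk.ne⟩⟩

lemma newTriples_spec {K : SimpleGraph ℕ} (hK : NoTripleHom K) {k : ℕ} (hk : k < 10)
    {c : ℕ → ℕ → Bool} (m : ℕ) {v o t : ℕ} (hvk : v + m = k)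
    (hc : Counts K (offset k) v o t)
    (h : newTriples (Nat.sub (Nat.pow 2 k) 1) (row K k k)
      ((List.range' v m).map (row K · k)) (2 ^ v) o t c = true) :
    ∃ o' t', Counts K (offset k) k o' t' ∧ c o' t' = true := by
  induction m generalizing v o t with
  | zero =>
    obtain rfl : v = k := hvk
    exact ⟨o, t, hc, h⟩
  | succ m ih =>
    have key : newTriples (Nat.sub (Nat.pow 2 k) 1) (row K k k)
        ((List.range' v (m + 1)).map (row K · k)) (2 ^ v) o t c =
        force (sameSide (Nat.sub (Nat.pow 2 k) 1) (row K v k) (2 ^ v) (row K k k)) fun x =>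
        ifZero (Nat.land t (pairs x)) (newTriples (Nat.sub (Nat.pow 2 k) 1) (row K k k)
          ((List.range' (v + 1) m).map (row K · k)) (2 * 2 ^ v) (Nat.lor o (pairs x))
            (Nat.lor t (Nat.land o (pairs x))) c) true := rfl
    have hx := fun q => homTriple_of_testBit_sameSide (K := K) (q := q)
      (show v < k by omega) hk
    rw [key, force_eq, ifZero_eq, if_pos (hc.land_eq_zero hK le_rfl (by omega) hx),
      ← Nat.pow_succ'] at h
    exact ih (by omega) (hc.add hx) h

/-- Update the rows after adding a vertex with bit `b` and row `r`. -/
def addRow (r b : ℕ) (rows : List ℕ) : ℕ → List ℕ :=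
  List.rec (fun _ => [r]) (fun N _ ih b' =>
    force (ifZero (Nat.land r b') N (Nat.lor N b)) fun N => N :: ih (Nat.mul 2 b')) rows

lemma addRow_spec {K : SimpleGraph ℕ} {k : ℕ} (m : ℕ) {v : ℕ} (hvk : v + m = k) :
    addRow (row K k k) (Nat.pow 2 k) ((List.range' v m).map (row K · k)) (2 ^ v) =
      (List.range' v (m + 1)).map (row K · (k + 1)) := by
  induction m generalizing v with
  | zero =>
    obtain rfl : v = k := hvk
    simp [addRow, row_self_succ]
  | succ m ih =>
    have key : addRow (row K k k) (Nat.pow 2 k) ((List.range' v (m + 1)).map (row K · k)) (2 ^ v) =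
      force (ifZero (Nat.land (row K k k) (2 ^ v)) (row K v k) (row K v k ||| 2 ^ k))
        fun N => N :: addRow (row K k k) (Nat.pow 2 k)
          ((List.range' (v + 1) m).map (row K · k)) (2 * 2 ^ v) := rfl
    have hz : Nat.land (row K k k) (2 ^ v) = 0 ↔ ¬ K.Adj v k := by
      rw [← Nat.pow_eq, land_two_pow_eq_zero, ← Bool.not_eq_true, testBit_row, K.adj_comm]
      have : v < k := by omega
      tauto
    have hrow : ifZero (Nat.land (row K k k) (2 ^ v)) (row K v k) (row K v k ||| 2 ^ k) =
        row K v (k + 1) := by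
      rw [ifZero_eq, row_succ]
      split_ifs <;> tauto
    rw [key, force_eq, ← Nat.pow_succ', ih (by omega), hrow, List.range'_succ (n := m + 1),
      List.map_cons]

/-- Add a vertex with row `r` to a graph on `k` vertices; succeeds if this violates
`NoTripleHom`, and continues with `c` otherwise. -/
def addVertex (k r : ℕ) (rows : List ℕ) (o t : ℕ) (c : List ℕ → ℕ → ℕ → Bool) : Bool :=
  force (Nat.sub (Nat.pow 2 k) 1) fun full =>
  newTriples full r rows 1 0 0 fun o₁ t₁ =>
  force (Nat.lor (Nat.lor o (homTriples full r)) (Nat.shiftLeft o₁ (offset k))) fun o' =>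
  force (Nat.lor (Nat.lor t (Nat.land o (homTriples full r))) (Nat.shiftLeft t₁ (offset k)))
    fun t' => c (addRow r (Nat.pow 2 k) rows 1) o' t'

/-- The rows of the subgraph induced by the first `k` vertices. -/
noncomputable def rowList (K : SimpleGraph ℕ) (k : ℕ) : List ℕ := (List.range' 0 k).map (row K · k)

lemma addVertex_spec {K : SimpleGraph ℕ} (hK : NoTripleHom K) {k : ℕ} (hk : k < 10) {o t : ℕ}
    {c : List ℕ → ℕ → ℕ → Bool} (hc : Counts K 0 k o t)
    (h : addVertex k (row K k k) (rowList K k) o t c = true) :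
    ∃ o' t', Counts K 0 (k + 1) o' t' ∧ c (rowList K (k + 1)) o' t' = true := by
  rw [addVertex, force_eq] at h
  obtain ⟨o₁, t₁, h₁, h⟩ := newTriples_spec hK hk k (zero_add k)
    ⟨fun q hq => by simp at hq, fun q hq => by simp at hq⟩ h
  rw [force_eq, force_eq] at h
  have hadd := addRow_spec (K := K) k (zero_add k)
  rw [pow_zero] at hadd
  rw [rowList, hadd] at h
  exact ⟨_, _, (hc.add fun q hq => homTriple_of_testBit le_rfl hq).lor (h₁.mono k.le_succ), h⟩

/-- The elements of `L` whose last six digits are at least those of `r`. -/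
def above (r : ℕ) (L : List ℕ) : List ℕ :=
  List.rec [] (fun d _ ih => Bool.rec ih (d :: ih) (Nat.ble (Nat.land r 63) (Nat.land d 63))) L

lemma mem_above {r d : ℕ} {L : List ℕ} (hd : d ∈ L) (h : r &&& 63 ≤ d &&& 63) :
    d ∈ above r L := by
  induction L with
  | nil => simp at hd
  | cons c L ih =>
    change d ∈ (Bool.rec (above r L) (c :: above r L) (Nat.ble (Nat.land r 63) (Nat.land c 63)) :
      List ℕ)
    rw [List.mem_cons] at hd
    cases hb : Nat.ble (Nat.land r 63) (Nat.land c 63) with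
    | true =>
      rcases hd with rfl | hd
      · exact List.mem_cons_self
      · exact List.mem_cons_of_mem _ (ih hd)
    | false =>
      rcases hd with rfl | hd
      · exact absurd ((Nat.ble_eq_true_of_le h).symm.trans hb) (by decide)
      · exact ih hd

/-- The parts of the singleton partition of the graph with the given rows. -/
def initialParts (rows : List ℕ) : ℕ → List Part :=
  List.rec (fun _ => [])
    (fun N _ ih b => .mk b N (Nat.xor (Nat.lor N b) 1023) :: ih (Nat.mul 2 b)) rows

/-- Search for a contraction strategy of the graph with the given rows. -/
noncomputable def solve (rows : List ℕ) : Bool := Part.dfs 4 (initialParts rows 1)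

lemma initialParts_spec {K : SimpleGraph ℕ} (m : ℕ) {v : ℕ} (hv : v + m = 10) :
    (initialParts ((List.range' v m).map (row K · 10)) (2 ^ v)).map Part.mask =
      (List.range' v m).map (2 ^ ·) ∧
    ∀ o ∈ initialParts ((List.range' v m).map (row K · 10)) (2 ^ v), o.Valid K := by
  induction m generalizing v with
  | zero => simp [initialParts]
  | succ m ih =>
    have key : initialParts ((List.range' v (m + 1)).map (row K · 10)) (2 ^ v) =
        .mk (2 ^ v) (row K v 10) (Nat.xor (Nat.lor (row K v 10) (2 ^ v)) 1023) ::
        initialParts ((List.range' (v + 1) m).map (row K · 10)) (2 * 2 ^ v) := rfl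
    obtain ⟨h1, h2⟩ := ih (v := v + 1) (by omega)
    rw [key, ← Nat.pow_succ', List.map_cons, h1, List.range'_succ, List.map_cons,
      List.forall_mem_cons]
    refine ⟨rfl, ⟨fun x y hx hy => ?_, fun x y hx hy => ?_⟩, h2⟩
    all_goals
      rw [Nat.testBit_two_pow, decide_eq_true_eq] at hx
      subst hx
    · exact (testBit_row.1 hy).2
    · rw [show 1023 = Nat.sub (Nat.pow 2 10) 1 from rfl, testBit_xor', testBit_full, testBit_lor',
        Nat.testBit_two_pow] at hy
      by_cases hi : y < 10
      · have h' : ¬ (row K v 10).testBit y = true ∧ ¬ v = y := by simpa [hi] using hy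
        rw [testBit_row] at h'
        exact ⟨h'.2, fun h => h'.1 ⟨hi, h⟩⟩
      · have h' : (row K v 10).testBit y = true ∨ v = y := by simpa [hi] using hy
        rw [testBit_row] at h'
        omega

lemma win_of_solve {K : SimpleGraph ℕ} (h : solve (rowList K 10) = true) : Win K singles := by
  obtain ⟨h1, h2⟩ := initialParts_spec (K := K) 10 (zero_add 10)
  have h3 : singles = (List.range' 0 10).map (2 ^ ·) := by decide
  rw [h3, ← h1]
  refine Part.win_of_dfs (fuel := 4) ?_ h2 h
  have := congrArg List.length h1
  simp only [List.length_map, List.length_range'] at this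
  exact this.le

/-- Add `fuel` further vertices with rows from `L` and solve the resulting graphs. -/
noncomputable def search (fuel : ℕ) : ℕ → List ℕ → ℕ → ℕ → List ℕ → Bool :=
  Nat.rec (fun _ rows _ _ _ => solve rows)
    (fun _ ih k rows o t L => forAll L fun r => addVertex k r rows o t fun rows o t =>
      force (Nat.succ k) fun k' => ih k' rows o t
        (extend (Nat.sub (Nat.pow 2 k') 1) (Nat.pow 2 k) t (above r L))) fuel

lemma row_land {K : SimpleGraph ℕ} {v k : ℕ} (hk : 6 ≤ k) : row K v k &&& 63 = row K v 6 := by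
  refine Nat.eq_of_testBit_eq fun i => ?_
  rw [show 63 = 2 ^ 6 - 1 from rfl, Nat.testBit_and, Nat.testBit_two_pow_sub_one]
  simp only [row, testBit_bits]
  by_cases hi : i < 6 <;> simp [hi]
  omega

lemma search_spec {K : SimpleGraph ℕ} (hK : NoTripleHom K)
    (hsort : ∀ v w, 6 ≤ v → v < w → w < 10 → row K v 6 ≤ row K w 6) (fuel : ℕ) {k o t : ℕ}
    (hk6 : 6 ≤ k) (hk : k + fuel = 10) {L : List ℕ} (hc : Counts K 0 k o t)
    (hL : ∀ v, k ≤ v → v < 10 → row K v k ∈ L)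
    (h : search fuel k (rowList K k) o t L = true) : Win K singles := by
  induction fuel generalizing k o t L with
  | zero =>
    obtain rfl : k = 10 := hk
    exact win_of_solve h
  | succ fuel ih =>
    have h' := forAll_eq_true.1 h (row K k k) (hL k le_rfl (by omega))
    obtain ⟨o', t', hc', h'⟩ := addVertex_spec hK (by omega) hc h'
    rw [force_eq] at h'
    refine ih (by omega) (by omega) hc' (fun v hv hv' => ?_) h'
    refine row_mem_extend hK hc' hv hv' (mem_above (hL v (by omega) hv') ?_)
    rw [row_land hk6, row_land hk6]
    exact hsort k v hk6 hv hv'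

/-- Build the graph whose `k`-th vertex has row `rs[k]`. -/
def build (rs : List ℕ) : ℕ → List ℕ → ℕ → ℕ → (List ℕ → ℕ → ℕ → Bool) → Bool :=
  List.rec (fun _ rows o t c => c rows o t)
    (fun r _ ih k rows o t c => force r fun r =>
      ifZero (Nat.land t (homTriples (Nat.sub (Nat.pow 2 k) 1) r))
        (addVertex k r rows o t fun rows o t => ih (Nat.succ k) rows o t c) true) rs

lemma build_spec {K : SimpleGraph ℕ} (hK : NoTripleHom K) {c : List ℕ → ℕ → ℕ → Bool} (m : ℕ)
    {k o t : ℕ} (hk : k + m ≤ 10) (hc : Counts K 0 k o t)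
    (h : build ((List.range' k m).map fun v => row K v v) k (rowList K k) o t c = true) :
    ∃ o' t', Counts K 0 (k + m) o' t' ∧ c (rowList K (k + m)) o' t' = true := by
  induction m generalizing k o t with
  | zero => exact ⟨o, t, hc, h⟩
  | succ m ih =>
    have key : build ((List.range' k (m + 1)).map fun v => row K v v) k (rowList K k) o t c =
      force (row K k k) fun r =>
      ifZero (Nat.land t (homTriples (Nat.sub (Nat.pow 2 k) 1) r))
        (addVertex k r (rowList K k) o t fun rows o t =>
          build ((List.range' (k + 1) m).map fun v => row K v v) (Nat.succ k) rows o t c)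
        true := rfl
    rw [key, force_eq, ifZero_eq, if_pos (hc.land_eq_zero hK le_rfl (by omega)
      fun q hq => homTriple_of_testBit le_rfl hq)] at h
    obtain ⟨o', t', hc', h'⟩ := addVertex_spec hK (by omega) hc h
    rw [show k + (m + 1) = k + 1 + m by omega]
    exact ih (by omega) hc' h'

/-- The triples `i < j < h` in the order of their indices. -/
def tripleList : List (ℕ × ℕ × ℕ) :=
  (List.range 10).flatMap fun h => (List.range h).flatMap fun j =>
    (List.range j).map fun i => (i, j, h)

lemma tripleList_getElem?_of_mem : ∀ p ∈ tripleList,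
    tripleList[tripleIndex p.1 p.2.1 p.2.2]? = some p := by
  decide +kernel

lemma tripleList_getElem? {i j h : ℕ} (hij : i < j) (hjh : j < h) (hh : h < 10) :
    tripleList[tripleIndex i j h]? = some (i, j, h) :=
  tripleList_getElem?_of_mem (i, j, h) (by simp [tripleList, hij, hjh, hh])

lemma HomTriple.eq {K : SimpleGraph ℕ} {v i j h : ℕ} (hij : i < j) (hjh : j < h) (hh : h < 10)
    (hv : HomTriple K v (tripleIndex i j h)) :
    (v ≠ i ∧ v ≠ j ∧ v ≠ h) ∧ Agree K v i j ∧ Agree K v j h := by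
  obtain ⟨i', j', h', hij', hjh', hh', hq, hv⟩ := hv
  have hi := tripleList_getElem? hij hjh hh
  rw [hq, tripleList_getElem? hij' hjh' hh', Option.some_inj, Prod.mk.injEq,
    Prod.mk.injEq] at hi
  obtain ⟨rfl, rfl, rfl⟩ := hi
  unfold Agree
  rcases hv with ⟨h1, h2, h3⟩ | hv
  · exact ⟨⟨h1.ne, h2.ne, h3.ne⟩, by tauto, by tauto⟩
  · tauto

lemma exists_relabels {L : List ℕ} (hL : L.Nodup) (hlt : ∀ x ∈ L, x < 10) :
    ∃ l, Relabels l ∧ ∀ n x, L[n]? = some x → l n = x := by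
  refine ⟨lab (L ++ (List.range 10).filter (· ∉ L)), relabels_lab ?_, fun n x h => ?_⟩
  · refine (List.perm_ext_iff_of_nodup (hL.append (List.nodup_range.filter _) ?_)
      List.nodup_range).2 fun x => ?_
    · exact fun x hx hx' => of_decide_eq_true (List.mem_filter.1 hx').2 hx
    · simp only [List.mem_append, List.mem_filter, List.mem_range, decide_eq_true_eq]
      have := hlt x
      tauto
  · have hn : n < L.length := (List.getElem?_eq_some_iff.1 h).1
    rw [lab, List.getD_eq_getElem?_getD, List.getElem?_append_left hn, h, Option.getD_some]

lemma noTripleHom_of_not_solvable {K : SimpleGraph ℕ} (hK : ¬ Solvable K) : NoTripleHom K := by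
  rintro q u hu v hv w hw huv huw hvw ⟨i, j, h, hij, hjh, hh, rfl, hu'⟩ hv' hw'
  obtain ⟨⟨u1, u2, u3⟩, u4, u5⟩ := HomTriple.eq hij hjh hh ⟨i, j, h, hij, hjh, hh, rfl, hu'⟩
  obtain ⟨⟨v1, v2, v3⟩, v4, v5⟩ := hv'.eq hij hjh hh
  obtain ⟨⟨w1, w2, w3⟩, w4, w5⟩ := hw'.eq hij hjh hh
  obtain ⟨l, hl, hlL⟩ := exists_relabels (L := [i, j, h, u, v, w])
    (by simp; omega) (by simp; omega)
  have e0 := hlL 0 i rfl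
  have e1 := hlL 1 j rfl
  have e2 := hlL 2 h rfl
  have e3 := hlL 3 u rfl
  have e4 := hlL 4 v rfl
  have e5 := hlL 5 w rfl
  refine hK (.of_comap hl (solvable_of_tripleHom ?_))
  simp only [TripleHom, agree_comap, e0, e1, e2, e3, e4, e5]
  exact ⟨⟨u4, u5⟩, ⟨v4, v5⟩, w4, w5⟩

/-! ### The graph induced on five neighbours of a vertex -/

/-- The `q`-th decimal digit of `T`. -/
def digit (T q : ℕ) : ℕ := Nat.mod (Nat.div T (Nat.pow 10 q)) 10

/-- The smaller end of the `q`-th pair of elements of `{1, …, 5}`. -/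
def fst (q : ℕ) : ℕ := digit 4321321211 q

/-- The larger end of the `q`-th pair of elements of `{1, …, 5}`. -/
def snd (q : ℕ) : ℕ := digit 5555444332 q

open Classical in
/-- The graph induced on `{1, …, 5}`, as a number. -/
noncomputable def code (K : SimpleGraph ℕ) : ℕ := bits (fun q => decide (K.Adj (fst q) (snd q))) 10

/-- `Nat.testBit`, in terms of functions with efficient kernel reduction. -/
def bit (m i : ℕ) : Bool := ifZero (Nat.land m (Nat.pow 2 i)) false true

lemma bit_eq (m i : ℕ) : bit m i = m.testBit i := by
  rw [bit, ifZero_eq]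
  split_ifs with h
  · exact (land_two_pow_eq_zero.1 h).symm
  · rw [land_two_pow_eq_zero, Bool.not_eq_false] at h
    exact h.symm

/-- The code with its digits permuted as prescribed by the decimal digits of `T`. -/
def permCode (m T : ℕ) : ℕ := bits (fun q => bit m (digit T q)) 10

/-- The transpositions of `{1, …, 5}` and the induced permutations of pairs. -/
def swaps : List (ℕ × ℕ × ℕ) :=
  [(1, 2, 9867534120), (1, 3, 9678345012), (1, 4, 6879103254), (1, 5, 3106549287),
    (2, 3, 9786453201), (2, 4, 7896240513), (2, 5, 4270593816), (3, 4, 8976521430),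
    (3, 5, 5821943760), (4, 5, 9543876210)]

lemma swaps_spec : ∀ p ∈ swaps, (1 ≤ p.1 ∧ p.1 ≤ 5 ∧ 1 ≤ p.2.1 ∧ p.2.1 ≤ 5) ∧
    ∀ q < 10, digit p.2.2 q < 10 ∧
      (Equiv.swap p.1 p.2.1 (fst q) = fst (digit p.2.2 q) ∧
        Equiv.swap p.1 p.2.1 (snd q) = snd (digit p.2.2 q) ∨
      Equiv.swap p.1 p.2.1 (fst q) = snd (digit p.2.2 q) ∧
        Equiv.swap p.1 p.2.1 (snd q) = fst (digit p.2.2 q)) := by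
  decide +kernel

lemma bits_congr {f g : ℕ → Bool} {n : ℕ} (h : ∀ i < n, f i = g i) : bits f n = bits g n :=
  Nat.eq_of_testBit_eq fun i => by
    rw [testBit_bits, testBit_bits]
    by_cases hi : i < n <;> simp [hi, h]

lemma code_comap_swap (K : SimpleGraph ℕ) {p : ℕ × ℕ × ℕ} (hp : p ∈ swaps) :
    code (K.comap (Equiv.swap p.1 p.2.1)) = permCode (code K) p.2.2 := by
  refine bits_congr fun q hq => ?_
  obtain ⟨h, h'⟩ := (swaps_spec p hp).2 q hq
  rw [bit_eq, code, testBit_bits, decide_eq_true h, Bool.true_and, decide_eq_decide,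
    SimpleGraph.comap_adj]
  rcases h' with ⟨h1, h2⟩ | ⟨h1, h2⟩
  · rw [h1, h2]
  · rw [h1, h2, K.adj_comm]

lemma fst_snd_mem : ∀ q < 10, (1 ≤ fst q ∧ fst q ≤ 5) ∧ 1 ≤ snd q ∧ snd q ≤ 5 := by decide

lemma code_comap (K : SimpleGraph ℕ) {l : ℕ → ℕ} (hl : ∀ i ≤ 5, l i = i) :
    code (K.comap l) = code K :=
  bits_congr fun q hq => by
    obtain ⟨h, h'⟩ := fst_snd_mem q hq
    rw [SimpleGraph.comap_adj, hl _ h.2, hl _ h'.2]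

lemma row_comap (K : SimpleGraph ℕ) {l : ℕ → ℕ} (hl : ∀ i ≤ 5, l i = i) (v : ℕ) :
    row (K.comap l) v 6 = row K (l v) 6 :=
  bits_congr fun i hi => by rw [SimpleGraph.comap_adj, hl i (by omega)]

/-- The row of the vertex `v` in the graph on `{0, …, 5}` in which `0` is adjacent to all other
vertices, which induce the graph with code `m`. -/
def firstRow (m v : ℕ) : ℕ :=
  bits (fun i => Nat.rec true
    (fun i' _ => bit m (Nat.add (Nat.div (Nat.mul (Nat.sub v 1) (Nat.sub v 2)) 2) i')) i) v

lemma fst_snd_eq : ∀ v < 6, ∀ i, i + 1 < v → (v - 1) * (v - 2) / 2 + i < 10 ∧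
    fst ((v - 1) * (v - 2) / 2 + i) = i + 1 ∧ snd ((v - 1) * (v - 2) / 2 + i) = v := by
  intro v hv i hi
  have hi' : i < 4 := by omega
  interval_cases v <;> first | omega | (interval_cases i <;> first | omega | decide)

lemma firstRow_code {K : SimpleGraph ℕ} (hK : ∀ v, 1 ≤ v → v ≤ 5 → K.Adj 0 v) {v : ℕ}
    (hv : v < 6) : firstRow (code K) v = row K v v := by
  refine bits_congr fun i hi => ?_
  cases i with
  | zero =>
    classical
    exact (decide_eq_true (hK v (by omega) (by omega)).symm).symm
  | succ i =>
    obtain ⟨h1, h2, h3⟩ := fst_snd_eq v hv i hi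
    change bit (code K) ((v - 1) * (v - 2) / 2 + i) = _
    rw [bit_eq, code, testBit_bits, decide_eq_true h1, Bool.true_and, decide_eq_decide, h2, h3,
      K.adj_comm]

/-- Search for contraction strategies of all graphs whose first six vertices are as in
`firstRow`. -/
noncomputable def solveCode (m : ℕ) : Bool :=
  build [firstRow m 0, firstRow m 1, firstRow m 2, firstRow m 3, firstRow m 4, firstRow m 5]
    0 [] 0 0 fun rows o t => search 4 6 rows o t
      (extend (Nat.sub (Nat.pow 2 6) 1) (Nat.pow 2 5) t (List.range 32))

lemma win_of_solveCode {K : SimpleGraph ℕ} (hK : NoTripleHom K)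
    (hadj : ∀ v, 1 ≤ v → v ≤ 5 → K.Adj 0 v)
    (hsort : ∀ v w, 6 ≤ v → v < w → w < 10 → row K v 6 ≤ row K w 6)
    (h : solveCode (code K) = true) : Win K singles := by
  rw [solveCode, firstRow_code hadj (by decide), firstRow_code hadj (by decide),
    firstRow_code hadj (by decide), firstRow_code hadj (by decide),
    firstRow_code hadj (by decide), firstRow_code hadj (by decide)] at h
  obtain ⟨o, t, hc, h⟩ := build_spec hK 6 (k := 0) (by decide)
    ⟨fun q hq => by simp at hq, fun q hq => by simp at hq⟩ h
  refine search_spec hK hsort 4 le_rfl rfl hc (fun v hv hv' => ?_) h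
  exact row_mem_extend hK hc (by omega) hv' (List.mem_range.2 (bits_lt _ 5))

/-- Some transposition decreases the code `m`. -/
def swapReducible (m : ℕ) : Bool :=
  List.rec false (fun p _ ih => either (Nat.ble (Nat.succ (permCode m p.2.2)) m) ih) swaps

lemma exists_of_swapReducible {m : ℕ} (h : swapReducible m = true) :
    ∃ p ∈ swaps, permCode m p.2.2 < m := by
  have key : ∀ L : List (ℕ × ℕ × ℕ), (List.rec false
      (fun p _ ih => either (Nat.ble (Nat.succ (permCode m p.2.2)) m) ih) L : Bool) = true →
      ∃ p ∈ L, permCode m p.2.2 < m := by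
    intro L hL
    induction L with
    | nil => cases hL
    | cons p L ih =>
      rcases either_eq_true.1 hL with h | h
      · exact ⟨p, List.mem_cons_self, Nat.le_of_ble_eq_true h⟩
      · obtain ⟨p, hp, h⟩ := ih h
        exact ⟨p, List.mem_cons_of_mem _ hp, h⟩
  exact key swaps h

lemma swapReducible_or_solveCode :
    forAll (List.range 1024) (fun m => force m fun m => either (swapReducible m) (solveCode m)) =
      true := by
  decide +kernel

/-! ### Normalizing the labels -/

/-- The quantity minimized by the normalized labelling. -/
noncomputable def weight (K : SimpleGraph ℕ) : ℕ :=
  (((code K * 64 + row K 6 6) * 64 + row K 7 6) * 64 + row K 8 6) * 64 + row K 9 6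

lemma relabels_swap {s t : ℕ} (hs : s < 10) (ht : t < 10) : Relabels (Equiv.swap s t) :=
  ⟨(Equiv.swap s t).injective, fun i hi => by
    rw [Equiv.swap_apply_def]
    split_ifs <;> assumption⟩

lemma not_swapReducible {K : SimpleGraph ℕ} (hadj : ∀ v, 1 ≤ v → v ≤ 5 → K.Adj 0 v)
    (hmin : ∀ l, Relabels l → (∀ v, 1 ≤ v → v ≤ 5 → K.Adj (l 0) (l v)) →
      weight K ≤ weight (K.comap l)) : ¬ swapReducible (code K) = true := by
  intro h
  obtain ⟨p, hp, h⟩ := exists_of_swapReducible h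
  obtain ⟨⟨h1, h2, h3, h4⟩, -⟩ := swaps_spec p hp
  have hw := hmin (Equiv.swap p.1 p.2.1) (relabels_swap (by omega) (by omega)) fun v hv hv' => by
    rw [Equiv.swap_apply_of_ne_of_ne (by omega) (by omega), Equiv.swap_apply_def]
    split_ifs
    exacts [hadj _ h3 h4, hadj _ h1 h2, hadj _ hv hv']
  rw [← code_comap_swap K hp] at h
  have hr : ∀ v, row (K.comap (Equiv.swap p.1 p.2.1)) v 6 < 64 := fun v => bits_lt _ 6
  have h6 := hr 6
  have h7 := hr 7
  have h8 := hr 8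
  have h9 := hr 9
  unfold weight at hw
  omega

lemma row_le_row {K : SimpleGraph ℕ} (hadj : ∀ v, 1 ≤ v → v ≤ 5 → K.Adj 0 v)
    (hmin : ∀ l, Relabels l → (∀ v, 1 ≤ v → v ≤ 5 → K.Adj (l 0) (l v)) →
      weight K ≤ weight (K.comap l)) :
    ∀ v w, 6 ≤ v → v < w → w < 10 → row K v 6 ≤ row K w 6 := by
  have hr : ∀ v, row K v 6 < 64 := fun v => bits_lt _ 6
  have hs : ∀ v, 6 ≤ v → v < 9 → weight K ≤ weight (K.comap (Equiv.swap v (v + 1))) ∧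
      (∀ i ≤ 5, Equiv.swap v (v + 1) i = i) := fun v hv hv' => by
    have hfix : ∀ i ≤ 5, Equiv.swap v (v + 1) i = i := fun i hi =>
      Equiv.swap_apply_of_ne_of_ne (by omega) (by omega)
    refine ⟨hmin _ (relabels_swap (by omega) (by omega)) fun u hu hu' => ?_, hfix⟩
    rw [hfix 0 (by decide), hfix u hu']
    exact hadj u hu hu'
  have h6 := hr 6
  have h7 := hr 7
  have h8 := hr 8
  have h9 := hr 9
  have h67 : row K 6 6 ≤ row K 7 6 := by
    obtain ⟨h, hl⟩ := hs 6 (by decide) (by decide)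
    simp only [weight, code_comap K hl, row_comap K hl, Nat.reduceAdd, Equiv.swap_apply_left,
      Equiv.swap_apply_right] at h
    rw [Equiv.swap_apply_of_ne_of_ne (by decide) (by decide),
      Equiv.swap_apply_of_ne_of_ne (by decide) (by decide)] at h
    omega
  have h78 : row K 7 6 ≤ row K 8 6 := by
    obtain ⟨h, hl⟩ := hs 7 (by decide) (by decide)
    simp only [weight, code_comap K hl, row_comap K hl, Nat.reduceAdd, Equiv.swap_apply_left,
      Equiv.swap_apply_right] at h
    rw [Equiv.swap_apply_of_ne_of_ne (by decide) (by decide),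
      Equiv.swap_apply_of_ne_of_ne (by decide) (by decide)] at h
    omega
  have h89 : row K 8 6 ≤ row K 9 6 := by
    obtain ⟨h, hl⟩ := hs 8 (by decide) (by decide)
    simp only [weight, code_comap K hl, row_comap K hl, Nat.reduceAdd, Equiv.swap_apply_left,
      Equiv.swap_apply_right] at h
    rw [Equiv.swap_apply_of_ne_of_ne (by decide) (by decide),
      Equiv.swap_apply_of_ne_of_ne (by decide) (by decide)] at h
    omega
  intro v w hv hvw hw
  have hv' : v < 9 := by omega
  interval_cases v <;> interval_cases w <;> omega

lemma solvable_of_minimal {K : SimpleGraph ℕ} (hadj : ∀ v, 1 ≤ v → v ≤ 5 → K.Adj 0 v)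
    (hmin : ∀ l, Relabels l → (∀ v, 1 ≤ v → v ≤ 5 → K.Adj (l 0) (l v)) →
      weight K ≤ weight (K.comap l)) : Solvable K := by
  by_contra hK
  have h := forAll_eq_true.1 swapReducible_or_solveCode (code K) (List.mem_range.2 (bits_lt _ 10))
  rw [force_eq, either_eq_true] at h
  exact hK (.of_win (win_of_solveCode (noTripleHom_of_not_solvable hK) hadj
    (row_le_row hadj hmin) (h.resolve_left (not_swapReducible hadj hmin))))

lemma solvable_of_adj {K : SimpleGraph ℕ} {l : ℕ → ℕ} (hl : Relabels l)
    (hadj : ∀ v, 1 ≤ v → v ≤ 5 → K.Adj (l 0) (l v)) : Solvable K := by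
  obtain ⟨l, ⟨hl, hadj⟩, hmin⟩ := (measure fun l : ℕ → ℕ => weight (K.comap l)).wf.has_min
    {l | Relabels l ∧ ∀ v, 1 ≤ v → v ≤ 5 → K.Adj (l 0) (l v)} ⟨l, hl, hadj⟩
  refine .of_comap hl (solvable_of_minimal hadj fun l' hl' hadj' => ?_)
  rw [SimpleGraph.comap_comap]
  exact not_lt.1 (hmin (l ∘ l') ⟨hl.comp hl', hadj'⟩)

lemma solvable_of_five_neighbors {K : SimpleGraph ℕ} {s : Finset ℕ} (hs : 5 ≤ s.card)
    (h : ∀ x ∈ s, x < 10 ∧ K.Adj 0 x) : Solvable K := by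
  obtain ⟨s', hs', hcard⟩ := Finset.exists_subset_card_eq hs
  have hlen : s'.toList.length = 5 := by rw [Finset.length_toList, hcard]
  have hmem : ∀ x ∈ s'.toList, x < 10 ∧ K.Adj 0 x := fun x hx => h x (hs' (by simpa using hx))
  obtain ⟨l, hl, hlL⟩ := exists_relabels (L := 0 :: s'.toList)
    (List.nodup_cons.2 ⟨fun h0 => (hmem 0 h0).2.ne rfl, s'.nodup_toList⟩)
    (List.forall_mem_cons.2 ⟨by decide, fun x hx => (hmem x hx).1⟩)
  refine solvable_of_adj hl fun v hv hv' => ?_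
  obtain ⟨v, rfl⟩ := Nat.exists_eq_add_of_le' hv
  have hvl : v < s'.toList.length := by omega
  rw [hlL 0 0 rfl, hlL (v + 1) s'.toList[v] (by
    rw [List.getElem?_cons_succ, List.getElem?_eq_getElem hvl])]
  exact (hmem _ (List.getElem_mem hvl)).2

theorem solvable (K : SimpleGraph ℕ) : Solvable K := by
  classical
  have hcard := Finset.card_filter_add_card_filter_not (s := Finset.Ico 1 10) (K.Adj 0)
  rw [Nat.card_Ico] at hcard
  rcases le_or_gt 5 ((Finset.Ico 1 10).filter (K.Adj 0)).card with h | h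
  · refine solvable_of_five_neighbors h fun x hx => ?_
    rw [Finset.mem_filter, Finset.mem_Ico] at hx
    exact ⟨hx.1.2, hx.2⟩
  · refine .of_compl (solvable_of_five_neighbors
      (s := (Finset.Ico 1 10).filter (¬ K.Adj 0 ·)) (by omega) fun x hx => ?_)
    rw [Finset.mem_filter, Finset.mem_Ico] at hx
    exact ⟨hx.1.2, by omega, hx.2⟩

lemma hasDSeq_four {V : Type*} [Fintype V] [Nonempty V] (G : SimpleGraph V)
    (h : Fintype.card V ≤ 10) : G.HasDSeq 4 := by
  let e : V ↪ ℕ := (Fintype.equivFin V).toEmbedding.trans Fin.valEmbedding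
  have he : ∀ v, e v < 10 := fun v => ((Fintype.equivFin V v).2).trans_le h
  obtain ⟨l, hl, hw⟩ := solvable (G.map e)
  choose f hf hfe using fun v => hl.exists_eq (he v)
  refine hasDSeq_of_win (e := f) (fun u v huv => e.injective ?_) hf (fun u v => ?_) hw
  · rw [← hfe, ← hfe, huv]
  · rw [SimpleGraph.comap_adj, hfe, hfe, SimpleGraph.map_adj_apply]

lemma not_hasDSeq_of_isEmpty {V : Type*} [IsEmpty V] (G : SimpleGraph V) (d : ℕ) :
    ¬ G.HasDSeq d := by
  rintro ⟨N, f, h0, hs, hN, -⟩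
  cases N with
  | zero =>
    rw [h0, Set.range_eq_empty] at hN
    exact Set.singleton_ne_empty _ hN.symm
  | succ N =>
    obtain ⟨A, hA, -⟩ := hs 0 N.succ_pos
    rw [h0, Set.range_eq_empty] at hA
    exact hA

end TwinWidthTen

/-- No graph on at most 10 vertices has twin-width exactly 5. -/
theorem no_twinWidth_five_on_le_ten {V : Type u} [Fintype V] (G : SimpleGraph V)
    (h : Fintype.card V ≤ 10) :
    G.twinWidth ≠ 5 := by
  intro h5
  rcases isEmpty_or_nonempty V with hV | hV
  · exact TwinWidthTen.not_hasDSeq_of_isEmpty G _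
      (Nat.sInf_mem (Nat.nonempty_of_sInf_eq_succ h5))
  · have h4 : G.twinWidth ≤ 4 := Nat.sInf_le (TwinWidthTen.hasDSeq_four G h)
    omega
end

section
/- The Wagner graph (the Möbius ladder on 8 vertices) has twin-width 2. -/
/-- The Wagner graph (the Möbius ladder on 8 vertices): the cycle
`v₀ v₁ … v₇ v₀` together with the four diagonals `vᵢ v_{i+4}`. -/
def wagnerGraph : SimpleGraph (Fin 8) :=
  SimpleGraph.fromRel (fun i j => j = i + 1 ∨ j = i + 4)

/-- A finite family of finite sets, viewed as a set of sets. -/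
def setFamily {V : Type*} (F : Finset (Finset V)) : Set (Set V) :=
  (fun S : Finset V => (S : Set V)) '' (F : Set (Finset V))

theorem twwStep_setFamily {V : Type*} [DecidableEq V] {F F' : Finset (Finset V)}
    (h : ∃ A ∈ F, ∃ B ∈ F, A ≠ B ∧ F' = insert (A ∪ B) (F \ {A, B})) :
    TwwStep (setFamily F) (setFamily F') := by
  obtain ⟨A, hA, B, hB, hAB, rfl⟩ := h
  refine ⟨A, ⟨A, hA, rfl⟩, B, ⟨B, hB, rfl⟩, fun h => hAB (Finset.coe_injective h), ?_⟩
  simp only [setFamily, Finset.coe_insert, Finset.coe_sdiff, Finset.coe_singleton,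
    Set.image_insert_eq, Set.image_sdiff Finset.coe_injective, Set.image_singleton,
    Finset.coe_union]

theorem SimpleGraph.redDeg_setFamily_le {V : Type*} [DecidableEq V] (G : SimpleGraph V)
    [DecidableRel G.Adj] (F : Finset (Finset V)) (S : Finset V) :
    G.redDeg (setFamily F) S ≤ {T ∈ F | T ≠ S ∧ (¬ ∀ x ∈ S, ∀ y ∈ T, G.Adj x y) ∧
      ¬ ∀ x ∈ S, ∀ y ∈ T, ¬ G.Adj x y}.card := by
  rw [SimpleGraph.redDeg, ← Set.ncard_coe_finset]
  refine (Set.ncard_le_ncard ?_ ((Finset.finite_toSet _).image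
    (fun T : Finset V => (T : Set V)))).trans (Set.ncard_image_le (Finset.finite_toSet _))
  rintro _ ⟨⟨T, hT, rfl⟩, hne, hmix⟩
  refine ⟨T, ?_, rfl⟩
  rw [Finset.mem_coe, Finset.mem_filter]
  exact ⟨hT, fun h => hne (h ▸ rfl), hmix⟩

instance wagnerGraph.instDecidableRelAdj : DecidableRel wagnerGraph.Adj := fun i j =>
  inferInstanceAs (Decidable (i ≠ j ∧ ((j = i + 1 ∨ j = i + 4) ∨ (i = j + 1 ∨ i = j + 4))))

/-- The partitions of a contraction sequence of width two for the Wagner graph. -/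
def wagnerPartition : ℕ → Finset (Finset (Fin 8))
  | 0 => {{0}, {1}, {2}, {3}, {4}, {5}, {6}, {7}}
  | 1 => {{0, 3}, {1}, {2}, {4}, {5}, {6}, {7}}
  | 2 => {{0, 3}, {1, 4}, {2}, {5}, {6}, {7}}
  | 3 => {{0, 3}, {1, 4}, {2, 5}, {6}, {7}}
  | 4 => {{0, 3, 6}, {1, 4}, {2, 5}, {7}}
  | 5 => {{0, 3, 6}, {1, 4, 7}, {2, 5}}
  | 6 => {{0, 2, 3, 5, 6}, {1, 4, 7}}
  | _ => {{0, 1, 2, 3, 4, 5, 6, 7}}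

theorem wagnerGraph_hasDSeq_two : wagnerGraph.HasDSeq 2 := by
  refine ⟨7, fun i => setFamily (wagnerPartition i), ?_, fun i hi => twwStep_setFamily ?_, ?_, ?_⟩
  · have h : wagnerPartition 0 = Finset.univ.image (fun v => {v}) := by decide
    ext P
    simp [h, setFamily]
  · revert i
    decide +kernel
  · have h : wagnerPartition 7 = {Finset.univ} := by decide
    simp [h, setFamily]
  · rintro i hi _ ⟨S, hS, rfl⟩
    refine (wagnerGraph.redDeg_setFamily_le _ S).trans ?_
    have key : ∀ i < 8, ∀ S ∈ wagnerPartition i, {T ∈ wagnerPartition i | T ≠ S ∧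
        (¬ ∀ x ∈ S, ∀ y ∈ T, wagnerGraph.Adj x y) ∧
        ¬ ∀ x ∈ S, ∀ y ∈ T, ¬ wagnerGraph.Adj x y}.card ≤ 2 := by
      decide +kernel
    exact le_of_eq_of_le (by congr!) (key i (by omega) S hS)

theorem wagnerGraph_exists_two_distinguishing : ∀ u v : Fin 8, u ≠ v →
    ∃ x y : Fin 8, x ≠ y ∧
      (x ≠ u ∧ x ≠ v ∧ ¬ (wagnerGraph.Adj u x ↔ wagnerGraph.Adj v x)) ∧
      (y ≠ u ∧ y ≠ v ∧ ¬ (wagnerGraph.Adj u y ↔ wagnerGraph.Adj v y)) := by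
  decide +kernel

theorem SimpleGraph.mixedPair_pair_singleton {V : Type*} {G : SimpleGraph V} {u v x : V}
    (h : ¬ (G.Adj u x ↔ G.Adj v x)) : G.MixedPair {u, v} {x} := by
  simp only [SimpleGraph.MixedPair, Set.mem_insert_iff, Set.mem_singleton_iff, forall_eq_or_imp,
    forall_eq]
  tauto

theorem two_le_of_wagnerGraph_hasDSeq {d : ℕ} (h : wagnerGraph.HasDSeq d) : 2 ≤ d := by
  obtain ⟨N, f, h0, hstep, hN, hred⟩ := h
  have hpos : 0 < N := by
    rcases Nat.eq_zero_or_pos N with rfl | h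
    · have hmem : ({0} : Set (Fin 8)) ∈ f 0 := h0 ▸ ⟨0, rfl⟩
      rw [hN, Set.mem_singleton_iff] at hmem
      have : (1 : Fin 8) ∈ ({0} : Set (Fin 8)) := hmem ▸ Set.mem_univ _
      simp at this
    · exact h
  obtain ⟨A, hA, B, hB, hAB, hf⟩ := hstep 0 hpos
  rw [h0] at hA hB hf
  obtain ⟨u, rfl⟩ := hA
  obtain ⟨v, rfl⟩ := hB
  obtain ⟨x, y, hxy, ⟨hxu, hxv, hx⟩, hyu, hyv, hy⟩ :=
    wagnerGraph_exists_two_distinguishing u v fun h => hAB (h ▸ rfl)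
  have hmem : ({u, v} : Set (Fin 8)) ∈ f (0 + 1) := hf ▸ Or.inl rfl
  have aux : ∀ z : Fin 8, z ≠ u → z ≠ v → ¬ (wagnerGraph.Adj u z ↔ wagnerGraph.Adj v z) →
      ({z} : Set (Fin 8)) ∈
        {Q ∈ f (0 + 1) | Q ≠ {u, v} ∧ wagnerGraph.MixedPair {u, v} Q} := by
    intro z hzu hzv hz
    refine ⟨hf ▸ Or.inr ⟨⟨z, rfl⟩, by simp [hzu, hzv]⟩, fun h => ?_,
      SimpleGraph.mixedPair_pair_singleton hz⟩
    have : u ∈ ({z} : Set (Fin 8)) := h ▸ Or.inl rfl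
    exact hzu this.symm
  refine le_trans ?_ (hred (0 + 1) hpos _ hmem)
  rw [← Set.ncard_pair (Set.singleton_injective.ne hxy)]
  exact Set.ncard_le_ncard (Set.pair_subset (aux x hxu hxv hx) (aux y hyu hyv hy))
    (Set.toFinite _)

/-- The Wagner graph has twin-width 2. -/
theorem wagnerGraph_twinWidth : wagnerGraph.twinWidth = 2 :=
  IsLeast.csInf_eq ⟨wagnerGraph_hasDSeq_two, fun _ => two_le_of_wagnerGraph_hasDSeq⟩
end

section
/- The 6 × 8 grid graph, i.e., the Cartesian (box) product of the path on 6 vertices and the path on 8 vertices, has twin-width 3. -/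
section ListedPartitions

variable {V : Type*}

/-- The family of parts listed by `ps`. -/
def listedParts (ps : List (List V)) : Set (Set V) :=
  {S | ∃ P ∈ ps, S = {v | v ∈ P}}

/-- The lists in `ps` are the parts of a partition of `V`. -/
structure IsListedPartition (ps : List (List V)) : Prop where
  nonempty : ∀ P ∈ ps, P ≠ []
  disjoint : ps.Pairwise List.Disjoint
  cover : ∀ v, ∃ P ∈ ps, v ∈ P

/-- Merge part `i` with part `j` of the remaining list, putting the union in front. -/
def mergeAt (ps : List (List V)) (i j : ℕ) : List (List V) :=
  ((ps[i]?).getD [] ++ ((ps.eraseIdx i)[j]?).getD []) :: (ps.eraseIdx i).eraseIdx j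

theorem IsListedPartition.perm {ps qs : List (List V)} (h : IsListedPartition ps)
    (hp : ps.Perm qs) : IsListedPartition qs where
  nonempty P hP := h.nonempty P (hp.mem_iff.2 hP)
  disjoint := (hp.pairwise_iff fun h => h.symm).1 h.disjoint
  cover v := by
    obtain ⟨P, hP, hv⟩ := h.cover v
    exact ⟨P, hp.mem_iff.1 hP, hv⟩

theorem listedParts_perm {ps qs : List (List V)} (hp : ps.Perm qs) :
    listedParts ps = listedParts qs := by
  ext S
  simp only [listedParts, Set.mem_ofPred_eq, hp.mem_iff]

theorem IsListedPartition.append {A B : List V} {ps : List (List V)}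
    (h : IsListedPartition (A :: B :: ps)) : IsListedPartition ((A ++ B) :: ps) where
  nonempty P hP := by
    rcases List.mem_cons.1 hP with rfl | hP
    · simp [h.nonempty A (by simp)]
    · exact h.nonempty P (by simp [hP])
  disjoint := by
    have hd := h.disjoint
    simp only [List.pairwise_cons, List.mem_cons, forall_eq_or_imp] at hd ⊢
    refine ⟨fun P hP => ?_, hd.2.2⟩
    rw [List.disjoint_append_left]
    exact ⟨hd.1.2 P hP, hd.2.1 P hP⟩
  cover v := by
    obtain ⟨P, hP, hv⟩ := h.cover v
    simp only [List.mem_cons] at hP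
    rcases hP with rfl | rfl | hP
    · exact ⟨_, List.mem_cons_self, by simp [hv]⟩
    · exact ⟨_, List.mem_cons_self, by simp [hv]⟩
    · exact ⟨P, by simp [hP], hv⟩

theorem setOf_mem_ne_of_disjoint {A B : List V} (hA : A ≠ []) (h : A.Disjoint B) :
    {v | v ∈ A} ≠ {v | v ∈ B} := by
  intro he
  obtain ⟨x, hx⟩ := List.exists_mem_of_ne_nil A hA
  exact h hx ((Set.ext_iff.1 he x).1 hx)

theorem IsListedPartition.twwStep {A B : List V} {ps : List (List V)}
    (h : IsListedPartition (A :: B :: ps)) :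
    TwwStep (listedParts (A :: B :: ps)) (listedParts ((A ++ B) :: ps)) := by
  have hd := h.disjoint
  simp only [List.pairwise_cons, List.mem_cons, forall_eq_or_imp] at hd
  refine ⟨{v | v ∈ A}, ⟨A, by simp, rfl⟩, {v | v ∈ B}, ⟨B, by simp, rfl⟩,
    setOf_mem_ne_of_disjoint (h.nonempty A (by simp)) hd.1.1, ?_⟩
  have hAB : {v | v ∈ A ++ B} = {v | v ∈ A} ∪ {v | v ∈ B} := by ext; simp
  ext S
  simp only [listedParts, Set.mem_ofPred_eq, List.mem_cons, exists_eq_or_imp, hAB,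
    Set.mem_insert_iff, Set.mem_sdiff, Set.mem_singleton_iff]
  refine or_congr_right ⟨?_, by tauto⟩
  rintro ⟨P, hP, rfl⟩
  refine ⟨Or.inr (Or.inr ⟨P, hP, rfl⟩), ?_⟩
  rintro (he | he)
  · exact setOf_mem_ne_of_disjoint (h.nonempty A (by simp)) (hd.1.2 P hP) he.symm
  · exact setOf_mem_ne_of_disjoint (h.nonempty B (by simp)) (hd.2.1 P hP) he.symm

theorem exists_perm_mergeAt {ps : List (List V)} {i j : ℕ} (hi : i < ps.length)
    (hj : j + 1 < ps.length) :
    ∃ A B qs, ps.Perm (A :: B :: qs) ∧ mergeAt ps i j = (A ++ B) :: qs := by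
  have hj' : j < (ps.eraseIdx i).length := by
    rw [List.length_eraseIdx_of_lt hi]; omega
  refine ⟨ps[i], (ps.eraseIdx i)[j], (ps.eraseIdx i).eraseIdx j, ?_, ?_⟩
  · exact ((List.getElem_cons_eraseIdx_perm hi).symm).trans
      ((List.getElem_cons_eraseIdx_perm hj').symm.cons _)
  · simp [mergeAt, List.getElem?_eq_getElem hi, List.getElem?_eq_getElem hj']

variable [DecidableEq V] (adj : V → V → Bool)

/-- Boolean test for a red pair of listed parts. -/
def mixedLists (P Q : List V) : Bool :=
  (P.any fun x => Q.any fun y => adj x y) && P.any fun x => Q.any fun y => !adj x y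

/-- Boolean test that all red degrees are at most `d`. -/
def redDegLE (d : ℕ) (ps : List (List V)) : Bool :=
  ps.all fun P => (ps.filter fun Q => mixedLists adj P Q && P != Q).length ≤ d

/-- Boolean test that the given merges lead from `ps` to a single part through
partitions of red degree at most `d`. -/
def isDSeq (d : ℕ) : List (ℕ × ℕ) → List (List V) → Bool
  | [], ps => redDegLE adj d ps && ps.length == 1
  | (i, j) :: t, ps => redDegLE adj d ps && decide (i < ps.length) &&
      decide (j + 1 < ps.length) && isDSeq d t (mergeAt ps i j)

variable {adj} {G : SimpleGraph V} {d : ℕ}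

theorem redDeg_le_of_redDegLE (hG : ∀ x y, G.Adj x y ↔ adj x y = true) {ps : List (List V)}
    (h : redDegLE adj d ps = true) {S : Set V} (hS : S ∈ listedParts ps) :
    G.redDeg (listedParts ps) S ≤ d := by
  obtain ⟨P, hP, rfl⟩ := hS
  simp only [redDegLE, List.all_eq_true, decide_eq_true_eq] at h
  refine le_trans ?_ (h P hP)
  set L := ps.filter fun Q => mixedLists adj P Q && P != Q with hL
  have hsub : {Q ∈ listedParts ps | Q ≠ {v | v ∈ P} ∧ G.MixedPair {v | v ∈ P} Q} ⊆
      ((L.toFinset.image fun Q => {v | v ∈ Q} : Finset (Set V)) : Set (Set V)) := by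
    rintro S ⟨⟨Q, hQ, rfl⟩, hne, hm⟩
    simp only [SimpleGraph.MixedPair, Set.mem_ofPred_eq, hG] at hm
    push Not at hm
    obtain ⟨⟨x, hx, y, hy, hxy⟩, ⟨x', hx', y', hy', hxy'⟩⟩ := hm
    simp only [Finset.coe_image, List.coe_toFinset, Set.mem_image, Set.mem_ofPred_eq, hL,
      List.mem_filter, Bool.and_eq_true, bne_iff_ne, mixedLists, List.any_eq_true]
    refine ⟨Q, ⟨hQ, ⟨⟨x', hx', y', hy', hxy'⟩, x, hx, y, hy, by simpa using hxy⟩, ?_⟩, rfl⟩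
    rintro rfl
    exact hne rfl
  unfold SimpleGraph.redDeg
  calc _ ≤ _ := Set.ncard_le_ncard hsub (Finset.finite_toSet _)
    _ ≤ L.toFinset.card := by rw [Set.ncard_coe_finset]; exact Finset.card_image_le
    _ ≤ L.length := L.toFinset_card_le

theorem exists_seq_of_isDSeq (hG : ∀ x y, G.Adj x y ↔ adj x y = true) (t : List (ℕ × ℕ))
    {ps : List (List V)} (hps : IsListedPartition ps) (h : isDSeq adj d t ps = true) :
    ∃ (N : ℕ) (f : ℕ → Set (Set V)), f 0 = listedParts ps ∧
      (∀ i < N, TwwStep (f i) (f (i + 1))) ∧ f N = {Set.univ} ∧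
      ∀ i ≤ N, ∀ P ∈ f i, G.redDeg (f i) P ≤ d := by
  induction t generalizing ps with
  | nil =>
    simp only [isDSeq, Bool.and_eq_true, beq_iff_eq] at h
    obtain ⟨hd, hl⟩ := h
    obtain ⟨P, rfl⟩ := List.length_eq_one_iff.1 hl
    refine ⟨0, fun _ => listedParts [P], rfl, by simp, ?_,
      fun _ _ _ => redDeg_le_of_redDegLE hG hd⟩
    have hu : {v | v ∈ P} = Set.univ :=
      Set.eq_univ_of_forall fun v => by simpa using hps.cover v
    ext S
    simp [listedParts, hu]
  | cons ij t ih =>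
    obtain ⟨i, j⟩ := ij
    simp only [isDSeq, Bool.and_eq_true, decide_eq_true_eq] at h
    obtain ⟨⟨⟨hd, hi⟩, hj⟩, ht⟩ := h
    obtain ⟨A, B, qs, hp, hm⟩ := exists_perm_mergeAt hi hj
    have hAB := hps.perm hp
    rw [hm] at ht
    obtain ⟨N, f, h0, hs, hN, hr⟩ := ih hAB.append ht
    refine ⟨N + 1, fun n => Nat.casesOn n (listedParts ps) f, rfl, ?_, hN, ?_⟩
    · rintro (_ | n) hn
      · change TwwStep (listedParts ps) (f 0)
        rw [h0, listedParts_perm hp]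
        exact hAB.twwStep
      · exact hs n (by omega)
    · rintro (_ | n) hn
      · exact fun P hP => redDeg_le_of_redDegLE hG hd hP
      · exact hr n (by omega)

theorem hasDSeq_of_isDSeq (hG : ∀ x y, G.Adj x y ↔ adj x y = true) {vs : List V}
    (hvs : vs.Nodup) (hmem : ∀ v, v ∈ vs) (t : List (ℕ × ℕ))
    (h : isDSeq adj d t (vs.map fun v => [v]) = true) : G.HasDSeq d := by
  have hps : IsListedPartition (vs.map fun v => [v]) := by
    refine ⟨by simp, ?_, fun v => by simpa using hmem v⟩
    rw [List.pairwise_map]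
    exact hvs.imp fun hne => by simpa [List.disjoint_singleton, eq_comm] using hne
  obtain ⟨N, f, h0, hf⟩ := exists_seq_of_isDSeq hG t hps h
  refine ⟨N, f, ?_, hf⟩
  rw [h0]
  ext S
  simp [listedParts, hmem, eq_comm]

end ListedPartitions

section RedDegree

variable {V : Type*} {G : SimpleGraph V}

theorem SimpleGraph.HasDSeq.mono {d e : ℕ} (h : G.HasDSeq d) (hde : d ≤ e) : G.HasDSeq e := by
  obtain ⟨N, f, h0, hs, hN, hd⟩ := h
  exact ⟨N, f, h0, hs, hN, fun i hi P hP => (hd i hi P hP).trans hde⟩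

theorem SimpleGraph.mixedPair_of_adj_of_not_adj {P Q : Set V} {a b x : V} (ha : a ∈ P)
    (hb : b ∈ P) (hx : x ∈ Q) (hax : G.Adj a x) (hbx : ¬ G.Adj b x) : G.MixedPair P Q :=
  ⟨fun h => hbx (h b hb x hx), fun h => h a ha x hx hax⟩

theorem SimpleGraph.two_lt_redDeg [Finite V] {F : Set (Set V)} {P Q₁ Q₂ Q₃ : Set V}
    (h₁ : Q₁ ∈ F ∧ Q₁ ≠ P ∧ G.MixedPair P Q₁) (h₂ : Q₂ ∈ F ∧ Q₂ ≠ P ∧ G.MixedPair P Q₂)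
    (h₃ : Q₃ ∈ F ∧ Q₃ ≠ P ∧ G.MixedPair P Q₃) (h₁₂ : Q₁ ≠ Q₂) (h₁₃ : Q₁ ≠ Q₃) (h₂₃ : Q₂ ≠ Q₃) :
    2 < G.redDeg F P :=
  (Set.two_lt_ncard_iff (Set.toFinite _)).2 ⟨Q₁, Q₂, Q₃, h₁, h₂, h₃, h₁₂, h₁₃, h₂₃⟩

end RedDegree

namespace Grid68

/-- The vertices of the `6 × 8` grid. -/
abbrev Vertex : Type := Fin 6 × Fin 8

/-- Adjacency of the grid as a Boolean function. -/
def adj (p q : Vertex) : Bool :=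
  (p.1.val == q.1.val && (p.2.val + 1 == q.2.val || q.2.val + 1 == p.2.val)) ||
  (p.2.val == q.2.val && (p.1.val + 1 == q.1.val || q.1.val + 1 == p.1.val))

theorem boxProd_adj_iff (p q : Vertex) :
    ((SimpleGraph.pathGraph 6) □ (SimpleGraph.pathGraph 8)).Adj p q ↔ adj p q = true := by
  simp only [SimpleGraph.boxProd_adj, SimpleGraph.pathGraph_adj, adj, Fin.ext_iff,
    Bool.or_eq_true, Bool.and_eq_true, beq_iff_eq]
  tauto

/-- All vertices, row by row. -/
def vertices : List Vertex := List.finRange 6 ×ˢ List.finRange 8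

theorem mem_vertices (v : Vertex) : v ∈ vertices := by
  exact List.mem_product.2 ⟨List.mem_finRange _, List.mem_finRange _⟩

theorem nodup_vertices : vertices.Nodup :=
  (List.nodup_finRange 6).product (List.nodup_finRange 8)

/-- The merges of a `3`-sequence, in the format of `mergeAt`. -/
def merges : List (ℕ × ℕ) := [
  (32, 40), (33, 40), (26, 39), (0, 1), (33, 38), (1, 1), (33, 37), (19, 26), (2, 2), (11,
  18), (1, 1), (3, 10), (4, 10), (1, 2), (4, 9), (1, 1), (6, 8), (2, 5), (2, 4), (11, 15),
  (2, 10), (2, 3), (21, 22), (1, 1), (21, 22), (0, 21), (13, 18), (1, 17), (3, 17), (1, 17),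
  (12, 16), (5, 15), (3, 14), (1, 6), (7, 8), (2, 5), (2, 5), (1, 3), (0, 0), (0, 6), (4,
  4), (2, 3), (0, 2), (1, 3), (1, 2), (1, 1), (0, 0)]

theorem isDSeq_merges : isDSeq adj 3 merges (vertices.map fun v => [v]) = true := by
  decide +kernel

/-- The reflection of each `2 × 2` corner block through its centre; other vertices are fixed. -/
def partner (p : Vertex) : Vertex :=
  if (p.1.val ≤ 1 || 4 ≤ p.1.val) && (p.2.val ≤ 1 || 6 ≤ p.2.val) then (p.1 ^^^ 1, p.2 ^^^ 1)
  else p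

/-- The parts containing `p` that occur in a `2`-sequence. -/
def options (p : Vertex) : List (List Vertex) :=
  if p = partner p then [[p]] else [[p], [p, partner p]]

/-- `x` lies outside `M` and has both neighbours and non-neighbours in `M`. -/
def splits (M : List Vertex) (x : Vertex) : Bool :=
  (M.any fun a => adj a x) && (M.any fun a => !adj a x) && M.all fun a => a != x

/-- `x` and `y` are in different parts throughout a `2`-sequence. -/
def separate (x y : Vertex) : Bool := x != y && x != partner y

/-- The vertices next to `p`, with wrap-around. -/
def around (p : Vertex) : List Vertex :=
  [(p.1 - 1, p.2), (p.1 + 1, p.2), (p.1, p.2 - 1), (p.1, p.2 + 1)]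

/-- Boolean test for three separate vertices splitting `M`. -/
def threeSplits (M : List Vertex) : Bool :=
  let S := (M.flatMap around).filter (splits M)
  S.any fun x => S.any fun y => separate x y && S.any fun z => separate x z && separate y z

def isCorner (p : Vertex) : Bool :=
  (p.1.val == 0 || p.1.val == 5) && (p.2.val == 0 || p.2.val == 7)

theorem partner_partner : ∀ p, partner (partner p) = p := by decide +kernel

theorem threeSplits_or_corners : vertices.all (fun u => vertices.all fun w =>
    !separate u w || (options u).all fun A => (options w).all fun B =>
      threeSplits (A ++ B) || (A == [u] && B == [w] && isCorner u && isCorner w)) = true := by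
  decide +kernel

theorem corner_conflict : ∀ u w : Vertex, isCorner u = true → isCorner w = true →
    separate u w = true →
    let b : Vertex := (u.1, u.2 ^^^ 1)
    let c : Vertex := (w.1, w.2 ^^^ 1)
    (splits [u, w] b && splits [u, w] (partner b) && splits [u, w] c && b != partner b &&
      separate b c && separate (partner b) c && (around b ++ around (partner b)).any fun x =>
        (around b ++ around (partner b)).any fun y =>
          splits [b, partner b] x && splits [b, partner b] y && separate x y &&
            x != u && x != w && y != u && y != w) = true := by
  decide +kernel

theorem mem_options {p : Vertex} {A : List Vertex} (hA : A ∈ options p) :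
    A = [p] ∨ A = [p, partner p] := by
  unfold options at hA
  split_ifs at hA
  · exact Or.inl (by simpa using hA)
  · simpa using hA

theorem eq_or_eq_partner_of_mem {p x : Vertex} {A : List Vertex} (hA : A ∈ options p)
    (hx : x ∈ A) : x = p ∨ x = partner p := by
  rcases mem_options hA with rfl | rfl
  · exact Or.inl (by simpa using hx)
  · simpa using hx

/-- All parts of `F` are singletons or pairs of partners, and they cover the grid. -/
structure IsSmall (F : Set (Set Vertex)) : Prop where
  parts : ∀ P ∈ F, ∃ p, ∃ A ∈ options p, P = {v | v ∈ A}
  cover : ∀ v, ∃ P ∈ F, v ∈ P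

theorem isSmall_singletons : IsSmall (Set.range fun v : Vertex => ({v} : Set Vertex)) where
  parts := by
    rintro _ ⟨v, rfl⟩
    refine ⟨v, [v], ?_, by ext; simp⟩
    unfold options
    split_ifs <;> simp
  cover v := ⟨{v}, ⟨v, rfl⟩, rfl⟩

theorem not_isSmall_univ : ¬ IsSmall {Set.univ} := by
  intro h
  obtain ⟨p, A, hA, hu⟩ := h.parts _ rfl
  have hmem (v : Vertex) : v = p ∨ v = partner p :=
    eq_or_eq_partner_of_mem hA ((Set.ext_iff.1 hu v).1 trivial)
  have h0 := hmem (0, 0)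
  have h1 := hmem (0, 1)
  have h2 := hmem (0, 2)
  have h01 : ((0, 0) : Vertex) ≠ (0, 1) := by decide
  have h02 : ((0, 0) : Vertex) ≠ (0, 2) := by decide
  have h12 : ((0, 1) : Vertex) ≠ (0, 2) := by decide
  grind

theorem IsSmall.ne_of_separate {F : Set (Set Vertex)} (hF : IsSmall F) {P Q : Set Vertex}
    (hP : P ∈ F) {x y : Vertex} (hx : x ∈ P) (hy : y ∈ Q) (h : separate x y = true) :
    P ≠ Q := by
  rintro rfl
  obtain ⟨p, A, hA, rfl⟩ := hF.parts P hP
  have hx' := eq_or_eq_partner_of_mem hA hx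
  have hy' := eq_or_eq_partner_of_mem hA hy
  have hp := partner_partner p
  simp only [separate, Bool.and_eq_true, bne_iff_ne] at h
  grind

theorem splits_spec {M : List Vertex} {x : Vertex} (h : splits M x = true) :
    x ∉ M ∧ ∀ Q : Set Vertex, x ∈ Q →
      ((SimpleGraph.pathGraph 6) □ (SimpleGraph.pathGraph 8)).MixedPair {v | v ∈ M} Q := by
  simp only [splits, Bool.and_eq_true, List.any_eq_true, List.all_eq_true, bne_iff_ne] at h
  obtain ⟨⟨⟨a, ha, hax⟩, b, hb, hbx⟩, hM⟩ := h
  refine ⟨fun hx => hM x hx rfl, fun Q hx => ?_⟩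
  refine SimpleGraph.mixedPair_of_adj_of_not_adj (a := a) (b := b) ha hb hx ?_ ?_
  · exact (boxProd_adj_iff a x).2 hax
  · rw [boxProd_adj_iff]
    simpa using hbx

/-- A vertex splitting a part `M` supplies a red neighbour of `M`. -/
theorem red_of_splits {F : Set (Set Vertex)} {M : List Vertex} {P : Set Vertex} {x : Vertex}
    (hP : P ∈ F) (hx : x ∈ P) (h : splits M x = true) :
    P ∈ F ∧ P ≠ {v | v ∈ M} ∧
      ((SimpleGraph.pathGraph 6) □ (SimpleGraph.pathGraph 8)).MixedPair {v | v ∈ M} P :=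
  ⟨hP, fun he => (splits_spec h).1 ((Set.ext_iff.1 he x).1 hx), (splits_spec h).2 P hx⟩

theorem mem_merge_of_not_mem {F : Set (Set Vertex)} {A B P : Set Vertex} {x : Vertex}
    (hP : P ∈ F) (hx : x ∈ P) (hxA : x ∉ A) (hxB : x ∉ B) :
    P ∈ insert (A ∪ B) (F \ {A, B}) := by
  refine Or.inr ⟨hP, ?_⟩
  rintro (rfl | rfl)
  · exact hxA hx
  · exact hxB hx

theorem IsSmall.exists_two_lt_redDeg_of_corners {F : Set (Set Vertex)} (hF : IsSmall F)
    {u w : Vertex} (hu : isCorner u = true) (hw : isCorner w = true)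
    (huw : separate u w = true) :
    ∃ P ∈ insert ({u} ∪ {w}) (F \ {{u}, {w}}),
      2 < ((SimpleGraph.pathGraph 6) □ (SimpleGraph.pathGraph 8)).redDeg
        (insert ({u} ∪ {w}) (F \ {{u}, {w}})) P := by
  have hM : ({u} ∪ {w} : Set Vertex) = {v | v ∈ [u, w]} := by ext; simp [or_comm]
  have key := corner_conflict u w hu hw huw
  simp only [Bool.and_eq_true, List.any_eq_true, bne_iff_ne] at key
  set b : Vertex := (u.1, u.2 ^^^ 1)
  set c : Vertex := (w.1, w.2 ^^^ 1)
  obtain ⟨⟨⟨⟨⟨⟨hb, hb'⟩, hc⟩, hbb⟩, hbc⟩, hbc'⟩, x, -, y, -,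
    ⟨⟨⟨⟨⟨⟨hx, hy⟩, hxy⟩, hxu⟩, hxw⟩, hyu⟩, hyw⟩⟩ := key
  have keep {P : Set Vertex} {z : Vertex} (hP : P ∈ F) (hz : z ∈ P) (h : z ∉ [u, w]) :
      P ∈ insert ({u} ∪ {w}) (F \ {{u}, {w}}) := by
    simp only [List.mem_cons, List.not_mem_nil, or_false, not_or] at h
    exact mem_merge_of_not_mem hP hz h.1 h.2
  by_cases hB : {v | v ∈ [b, partner b]} ∈ F
  · obtain ⟨X, hX, hxX⟩ := hF.cover x
    obtain ⟨Y, hY, hyY⟩ := hF.cover y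
    have hbB : b ∈ {v | v ∈ [b, partner b]} := by simp
    have hbM := (splits_spec hb).1
    refine ⟨_, keep hB hbB hbM, SimpleGraph.two_lt_redDeg
      (Q₁ := {u} ∪ {w}) ⟨Set.mem_insert _ _, ?_, ?_⟩
      (red_of_splits (keep hX hxX (by simp [hxu, hxw])) hxX hx)
      (red_of_splits (keep hY hyY (by simp [hyu, hyw])) hyY hy) ?_ ?_
      (hF.ne_of_separate hX hxX hyY hxy)⟩
    · rw [hM]
      exact fun he => hbM ((Set.ext_iff.1 he b).2 hbB)
    · have hm := (splits_spec hb).2 _ hbB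
      rw [hM]
      exact ⟨fun h => hm.1 fun p hp q hq => (h q hq p hp).symm,
        fun h => hm.2 fun p hp q hq hpq => h q hq p hp hpq.symm⟩
    · rintro rfl
      simp [hxu, hxw] at hxX
    · rintro rfl
      simp [hyu, hyw] at hyY
  · obtain ⟨X, hX, hxX⟩ := hF.cover b
    obtain ⟨Y, hY, hyY⟩ := hF.cover (partner b)
    obtain ⟨Z, hZ, hzZ⟩ := hF.cover c
    refine ⟨_, Set.mem_insert _ _, ?_⟩
    nth_rewrite 2 [hM]
    refine SimpleGraph.two_lt_redDeg
      (red_of_splits (keep hX hxX (splits_spec hb).1) hxX hb)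
      (red_of_splits (keep hY hyY (splits_spec hb').1) hyY hb')
      (red_of_splits (keep hZ hzZ (splits_spec hc).1) hzZ hc) ?_
      (hF.ne_of_separate hX hxX hzZ hbc) (hF.ne_of_separate hY hyY hzZ hbc')
    rintro rfl
    obtain ⟨p, A, hA, rfl⟩ := hF.parts X hX
    have hpp := partner_partner p
    rcases mem_options hA with rfl | rfl
    · simp only [Set.mem_ofPred_eq, List.mem_singleton] at hxX hyY
      exact hbb (hxX.trans hyY.symm)
    · apply hB
      simp only [Set.mem_ofPred_eq, List.mem_cons, List.not_mem_nil, or_false] at hxX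
      rcases hxX with h | h
      · rwa [h]
      · rw [h, hpp]
        convert hX using 1
        ext v
        simp [or_comm]

theorem exists_option_append {u w : Vertex} {A B : List Vertex} (h : separate u w = false)
    (hA : A ∈ options u) (hB : B ∈ options w) :
    ∃ p, ∃ C ∈ options p, {v | v ∈ A} ∪ {v | v ∈ B} = {v | v ∈ C} := by
  have huw : u = w ∨ u = partner w := by
    by_contra hne
    simp_all [separate]
  have hw := partner_partner w
  have self_mem (p : Vertex) : [p] ∈ options p := by unfold options; split_ifs <;> simp
  have hsub : ∀ v, v ∈ A ∨ v ∈ B → v = w ∨ v = partner w := by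
    rintro v (hv | hv)
    · have := eq_or_eq_partner_of_mem hA hv
      grind
    · exact eq_or_eq_partner_of_mem hB hv
  have hwB : w ∈ B := by
    rcases mem_options hB with rfl | rfl <;> simp
  by_cases hp : partner w ∈ A ∨ partner w ∈ B
  · by_cases hfix : w = partner w
    · refine ⟨w, [w], self_mem w, ?_⟩
      ext v
      simp only [Set.mem_union, Set.mem_ofPred_eq, List.mem_singleton]
      grind
    · refine ⟨w, [w, partner w], by simp [options, hfix], ?_⟩
      ext v
      simp only [Set.mem_union, Set.mem_ofPred_eq, List.mem_cons, List.not_mem_nil, or_false]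
      grind
  · refine ⟨w, [w], self_mem w, ?_⟩
    ext v
    simp only [Set.mem_union, Set.mem_ofPred_eq, List.mem_singleton]
    grind

theorem IsSmall.twwStep {F F' : Set (Set Vertex)} (hF : IsSmall F) (hs : TwwStep F F')
    (hd : ∀ P ∈ F',
      ((SimpleGraph.pathGraph 6) □ (SimpleGraph.pathGraph 8)).redDeg F' P ≤ 2) :
    IsSmall F' := by
  obtain ⟨P, hP, Q, hQ, -, rfl⟩ := hs
  obtain ⟨u, A, hA, rfl⟩ := hF.parts P hP
  obtain ⟨w, B, hB, rfl⟩ := hF.parts Q hQ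
  have hM : ({v | v ∈ A} ∪ {v | v ∈ B} : Set Vertex) = {v | v ∈ A ++ B} := by ext; simp
  have hcover (v : Vertex) :
      ∃ R ∈ insert ({v | v ∈ A} ∪ {v | v ∈ B}) (F \ {{v | v ∈ A}, {v | v ∈ B}}), v ∈ R := by
    by_cases hv : v ∈ A ++ B
    · exact ⟨_, Set.mem_insert _ _, by simpa using hv⟩
    · rw [List.mem_append, not_or] at hv
      obtain ⟨R, hR, hvR⟩ := hF.cover v
      exact ⟨R, mem_merge_of_not_mem hR hvR hv.1 hv.2, hvR⟩
  refine ⟨?_, hcover⟩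
  rintro R (rfl | hR)
  swap
  · exact hF.parts R hR.1
  rcases Bool.eq_false_or_eq_true (separate u w) with hsep | hsep
  swap
  · exact exists_option_append hsep hA hB
  have hcase := threeSplits_or_corners
  simp only [List.all_eq_true] at hcase
  replace hcase := hcase u (mem_vertices u) w (mem_vertices w)
  simp only [hsep, Bool.not_true, Bool.false_or, List.all_eq_true, Bool.or_eq_true] at hcase
  rcases hcase A hA B hB with h3 | hc
  · exfalso
    simp only [threeSplits, List.any_eq_true, Bool.and_eq_true, List.mem_filter] at h3
    obtain ⟨x, ⟨-, hx⟩, y, ⟨-, hy⟩, hxy, z, ⟨-, hz⟩, hxz, hyz⟩ := h3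
    have part {x : Vertex} (hx : splits (A ++ B) x = true) :
        ∃ X ∈ F, x ∈ X ∧
          X ∈ insert ({v | v ∈ A} ∪ {v | v ∈ B}) (F \ {{v | v ∈ A}, {v | v ∈ B}}) := by
      have hx' := (splits_spec hx).1
      rw [List.mem_append, not_or] at hx'
      obtain ⟨X, hX, hxX⟩ := hF.cover x
      exact ⟨X, hX, hxX, mem_merge_of_not_mem hX hxX hx'.1 hx'.2⟩
    obtain ⟨X, hX, hxX, hX'⟩ := part hx
    obtain ⟨Y, hY, hyY, hY'⟩ := part hy
    obtain ⟨Z, hZ, hzZ, hZ'⟩ := part hz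
    have hred := SimpleGraph.two_lt_redDeg (red_of_splits hX' hxX hx)
      (red_of_splits hY' hyY hy) (red_of_splits hZ' hzZ hz)
      (hF.ne_of_separate hX hxX hyY hxy) (hF.ne_of_separate hX hxX hzZ hxz)
      (hF.ne_of_separate hY hyY hzZ hyz)
    rw [← hM] at hred
    exact absurd (hd _ (Set.mem_insert _ _)) (not_le.2 hred)
  · exfalso
    simp only [Bool.and_eq_true, beq_iff_eq] at hc
    obtain ⟨⟨⟨rfl, rfl⟩, hu⟩, hw⟩ := hc
    have hsing (v : Vertex) : {x | x ∈ [v]} = ({v} : Set Vertex) := by ext; simp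
    simp only [hsing] at hd
    obtain ⟨R, hR, hlt⟩ := hF.exists_two_lt_redDeg_of_corners hu hw hsep
    exact absurd (hd R hR) (not_le.2 hlt)

theorem not_hasDSeq_two :
    ¬ ((SimpleGraph.pathGraph 6) □ (SimpleGraph.pathGraph 8)).HasDSeq 2 := by
  rintro ⟨N, f, h0, hs, hN, hd⟩
  have small (i : ℕ) (hi : i ≤ N) : IsSmall (f i) := by
    induction i with
    | zero => rw [h0]; exact isSmall_singletons
    | succ i ih => exact (ih (by omega)).twwStep (hs i (by omega)) (hd (i + 1) hi)
  exact not_isSmall_univ (hN ▸ small N le_rfl)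

end Grid68

/-- The `6 × 8` grid graph — the Cartesian (box) product of the
path on 6 vertices and the path on 8 vertices — has twin-width 3. -/
theorem grid_6_8_twinWidth :
    ((SimpleGraph.pathGraph 6) □ (SimpleGraph.pathGraph 8)).twinWidth = 3 := by
  have h3 : ((SimpleGraph.pathGraph 6) □ (SimpleGraph.pathGraph 8)).HasDSeq 3 :=
    hasDSeq_of_isDSeq Grid68.boxProd_adj_iff Grid68.nodup_vertices Grid68.mem_vertices _
      Grid68.isDSeq_merges
  refine le_antisymm (Nat.sInf_le h3) (le_csInf ⟨3, h3⟩ fun d hd => ?_)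
  by_contra hlt
  exact Grid68.not_hasDSeq_two (hd.mono (by omega))
end
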